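/- arXiv:math/0012102 — 2 statements merged into one kernel-verified Lean document; each statement's English description precedes it below -/
import Mathlib

section
/- Let G act properly discontinuously by semi-simple isometries on a CAT(0) metric space X of covering dimension ≤ 2, let g ∈ G have infinite order, and let h₁, h₂ ∈ G be such that ⟨h₁, g⟩ and ⟨h₂, g⟩ are free abelian subgroups of rank 2. Set Π₁ = Min(h₁) ∩ Min(g) and Π₂ = Min(h₂) ∩ Min(g), and assume Π₁ ≠ Π₂. Then exactly one of the following holds: (1) Π₁ ∩ Π₂ = ∅; (2) Π₁ ∩ Π₂ is a single axis of g, i.e. the image of a g-invariant isometric embedding ℝ → X along which g translates by ℓ(g); (3) there exist w > 0 and an isometric embedding j : [0,w] × ℝ → X (with the Euclidean product metric on [0,w] × ℝ) whose image is Π₁ ∩ Π₂ and such that each line j({s} × ℝ) is an axis of g. -/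
/-! Common definitions: geodesic spaces, CAT(0) spaces, covering dimension,
translation length, semi-simple isometries, properly discontinuous actions,
ℝ-trees, axes, flat strips, and Artin group presentations. -/

/-- The alternating product `x y x y ⋯` of length `k`. -/
def altProd {G : Type*} [Monoid G] (x y : G) : ℕ → G
  | 0 => 1
  | Nat.succ k => x * altProd y x k

/-- `γ` is a geodesic from `x` to `y`, i.e. an isometric map of `[0, dist x y]`
into the space with endpoints `x` and `y`. -/
def IsGeodesic {X : Type*} [MetricSpace X] (x y : X) (γ : ℝ → X) : Prop :=
  γ 0 = x ∧ γ (dist x y) = y ∧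
    ∀ s ∈ Set.Icc (0:ℝ) (dist x y), ∀ t ∈ Set.Icc (0:ℝ) (dist x y),
      dist (γ s) (γ t) = |s - t|

/-- A metric space is geodesic if any two points are joined by a geodesic. -/
def IsGeodesicSpace (X : Type*) [MetricSpace X] : Prop :=
  ∀ x y : X, ∃ γ : ℝ → X, IsGeodesic x y γ

/-- The comparison point at arclength parameter `s` on the Euclidean segment from `x'`
to `y'`, where `d` is the length of the corresponding side of the original triangle. -/
noncomputable def cmpPoint (d : ℝ) (x' y' : EuclideanSpace ℝ (Fin 2)) (s : ℝ) :
    EuclideanSpace ℝ (Fin 2) :=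
  x' + (s / d) • (y' - x')

/-- A CAT(0) space: a geodesic metric space in which every geodesic triangle satisfies
the comparison inequality with respect to a comparison triangle in the Euclidean plane. -/
def IsCAT0 (X : Type*) [MetricSpace X] : Prop :=
  IsGeodesicSpace X ∧
  ∀ (x y z : X) (γ₁ γ₂ : ℝ → X), IsGeodesic x y γ₁ → IsGeodesic x z γ₂ →
    ∀ x' y' z' : EuclideanSpace ℝ (Fin 2),
      dist x' y' = dist x y → dist x' z' = dist x z → dist y' z' = dist y z →
      ∀ s ∈ Set.Icc (0:ℝ) (dist x y), ∀ t ∈ Set.Icc (0:ℝ) (dist x z),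
        dist (γ₁ s) (γ₂ t) ≤
          dist (cmpPoint (dist x y) x' y' s) (cmpPoint (dist x z) x' z' t)

/-- Covering dimension at most `n`: every open cover admits an open refinement in which
every point lies in at most `n + 1` members. -/
def CovDimLE (X : Type*) [TopologicalSpace X] (n : ℕ) : Prop :=
  ∀ U : Set (Set X), (∀ u ∈ U, IsOpen u) → ⋃₀ U = Set.univ →
    ∃ V : Set (Set X), (∀ v ∈ V, IsOpen v) ∧ ⋃₀ V = Set.univ ∧
      (∀ v ∈ V, ∃ u ∈ U, v ⊆ u) ∧
      ∀ x : X, ∃ F : Finset (Set X), F.card ≤ n + 1 ∧ {v | v ∈ V ∧ x ∈ v} ⊆ ↑F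

/-- The translation length of a self-map of a metric space. -/
noncomputable def transLen {X : Type*} [MetricSpace X] (f : X → X) : ℝ :=
  sInf (Set.range fun x => dist x (f x))

/-- A self-map is semi-simple if its translation length is attained. -/
def SemiSimple {X : Type*} [MetricSpace X] (f : X → X) : Prop :=
  ∃ x, dist x (f x) = transLen f

/-- The minset of a self-map of a metric space. -/
def MinSet {X : Type*} [MetricSpace X] (f : X → X) : Set X :=
  {x | dist x (f x) = transLen f}

/-- An action by isometries (given by a homomorphism to the isometry group) is properly
discontinuous if each compact set meets only finitely many of its translates. -/
def ProperlyDisc {G X : Type*} [Group G] [MetricSpace X] (φ : G →* (X ≃ᵢ X)) : Prop :=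
  ∀ K : Set X, IsCompact K → Set.Finite {g : G | ((φ g) '' K ∩ K).Nonempty}

/-- An ℝ-tree: a geodesic metric space satisfying the four-point condition. -/
def IsRTree (T : Type*) [MetricSpace T] : Prop :=
  IsGeodesicSpace T ∧
  ∀ x y z w : T,
    dist x y + dist z w ≤ max (dist x z + dist y w) (dist x w + dist y z)

/-- `L` is an axis of `f`: an `f`-invariant geodesic line along which `f` translates
by its translation length. -/
def IsAxisOf {X : Type*} [MetricSpace X] (f : X → X) (L : Set X) : Prop :=
  ∃ c : ℝ → X, (∀ s t : ℝ, dist (c s) (c t) = |s - t|) ∧ Set.range c = L ∧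
    ∀ t : ℝ, f (c t) = c (t + transLen f)

/-- `j` is an isometric embedding of the Euclidean strip `[0,w] × ℝ` into `X`. -/
def FlatStrip {X : Type*} [MetricSpace X] (w : ℝ) (j : Set.Icc (0:ℝ) w × ℝ → X) : Prop :=
  ∀ p q : Set.Icc (0:ℝ) w × ℝ,
    dist (j p) (j q) = Real.sqrt (((p.1 : ℝ) - (q.1 : ℝ))^2 + (p.2 - q.2)^2)

/-- The set `S` is a flat strip of some positive width `w`, each of whose vertical lines
is an axis of `f`. -/
def StripWithAxes {X : Type*} [MetricSpace X] (f : X → X) (S : Set X) : Prop :=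
  ∃ w : ℝ, 0 < w ∧ ∃ j : Set.Icc (0:ℝ) w × ℝ → X,
    FlatStrip w j ∧ Set.range j = S ∧
    ∀ s : Set.Icc (0:ℝ) w, IsAxisOf f (Set.range fun t : ℝ => j (s, t))

/-- The relations of the Artin group `A(m,n,2)` on generators `a = 0`, `b = 1`, `c = 2`:
`(a,b)_m = (b,a)_m`, `(b,c)_n = (c,b)_n` and `ac = ca`. -/
def artinRel3 (m n : ℕ) : Set (FreeGroup (Fin 3)) :=
  { altProd (FreeGroup.of 0) (FreeGroup.of 1) m *
      (altProd (FreeGroup.of 1) (FreeGroup.of 0) m)⁻¹,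
    altProd (FreeGroup.of 1) (FreeGroup.of 2) n *
      (altProd (FreeGroup.of 2) (FreeGroup.of 1) n)⁻¹,
    FreeGroup.of 0 * FreeGroup.of 2 * (FreeGroup.of 0)⁻¹ * (FreeGroup.of 2)⁻¹ }

/-- The relation of the dihedral-type Artin group `A(m)` on generators `a = 0`, `b = 1`:
`(a,b)_m = (b,a)_m`. -/
def dihedralRel (m : ℕ) : Set (FreeGroup (Fin 2)) :=
  { altProd (FreeGroup.of 0) (FreeGroup.of 1) m *
      (altProd (FreeGroup.of 1) (FreeGroup.of 0) m)⁻¹ }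

section CAT0Basics

variable {X : Type*} [MetricSpace X]

/-- Every triangle in a metric space with non-degenerate first side has a comparison triangle. -/
theorem exists_comparison_triangle {a b c : ℝ} (ha : 0 < a) (hb : 0 ≤ b) (hc : 0 ≤ c)
    (habc : a ≤ b + c) (hbca : b ≤ a + c) (hcab : c ≤ a + b) :
    ∃ x y z : EuclideanSpace ℝ (Fin 2), dist x y = a ∧ dist x z = b ∧ dist y z = c := by
  set p : ℝ := (a ^ 2 + b ^ 2 - c ^ 2) / (2 * a) with hp
  have hpa : 2 * a * p = a ^ 2 + b ^ 2 - c ^ 2 := by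
    rw [hp]; field_simp
  have hq : 0 ≤ b ^ 2 - p ^ 2 := by
    have h4 : 0 ≤ 4 * a ^ 2 * (b ^ 2 - p ^ 2) := by
      have : 4 * a ^ 2 * (b ^ 2 - p ^ 2)
          = ((a + b - c) * (a + b + c)) * ((c + a - b) * (c + b - a)) := by
        have : 4 * a ^ 2 * (b ^ 2 - p ^ 2) = 4 * a ^ 2 * b ^ 2 - (2 * a * p) ^ 2 := by ring
        rw [this, hpa]; ring
      rw [this]
      apply mul_nonneg <;> apply mul_nonneg <;> linarith
    exact nonneg_of_mul_nonneg_right h4 (by positivity)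
  refine ⟨!₂[0, 0], !₂[a, 0], !₂[p, √(b ^ 2 - p ^ 2)], ?_, ?_, ?_⟩
  · rw [EuclideanSpace.dist_eq]
    simp [Real.sqrt_sq ha.le, Real.dist_eq]
  · rw [EuclideanSpace.dist_eq]
    simp only [Fin.sum_univ_two, Real.dist_eq, sq_abs]
    simp only [Matrix.cons_val_zero, Matrix.cons_val_one, zero_sub, neg_sq]
    rw [Real.sq_sqrt hq, add_sub_cancel, Real.sqrt_sq hb]
  · rw [EuclideanSpace.dist_eq]
    simp only [Fin.sum_univ_two, Real.dist_eq, sq_abs]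
    simp only [Matrix.cons_val_zero, Matrix.cons_val_one, zero_sub, neg_sq]
    rw [Real.sq_sqrt hq, show (a - p) ^ 2 + (b ^ 2 - p ^ 2) = c ^ 2 by linarith [hpa],
      Real.sqrt_sq hc]

theorem IsGeodesic.reverse {x y : X} {γ : ℝ → X} (h : IsGeodesic x y γ) :
    IsGeodesic y x fun t => γ (dist x y - t) := by
  obtain ⟨h0, h1, h2⟩ := h
  refine ⟨by simpa using h1, by simpa [dist_comm y x] using h0, fun s hs t ht => ?_⟩
  rw [dist_comm y x] at hs ht
  rw [h2 _ ⟨by linarith [hs.2], by linarith [hs.1]⟩ _ ⟨by linarith [ht.2], by linarith [ht.1]⟩,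
    abs_sub_comm]
  congr 1; ring

theorem IsGeodesic.comp_isometry {x y : X} {γ : ℝ → X} (h : IsGeodesic x y γ) {f : X → X}
    (hf : Isometry f) : IsGeodesic (f x) (f y) (f ∘ γ) := by
  obtain ⟨h0, h1, h2⟩ := h
  refine ⟨by simp [h0], by simp [hf.dist_eq, h1], fun s hs t ht => ?_⟩
  rw [hf.dist_eq] at hs ht
  simpa [hf.dist_eq] using h2 s hs t ht

/-- Two geodesics issuing from a common point diverge at least linearly. -/
theorem IsCAT0.dist_geodesic_le_of_common_start (hX : IsCAT0 X) {x y z : X} {γ₁ γ₂ : ℝ → X}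
    (h₁ : IsGeodesic x y γ₁) (h₂ : IsGeodesic x z γ₂) {s : ℝ} (hs : s ∈ Set.Icc (0 : ℝ) 1) :
    dist (γ₁ (s * dist x y)) (γ₂ (s * dist x z)) ≤ s * dist y z := by
  rcases eq_or_ne x y with rfl | hxy
  · have h00 : γ₁ 0 = γ₂ 0 := h₁.1.trans h₂.1.symm
    have := h₂.2.2 0 ⟨le_rfl, dist_nonneg⟩ (s * dist x z)
      ⟨mul_nonneg hs.1 dist_nonneg, mul_le_of_le_one_left dist_nonneg hs.2⟩
    simp only [dist_self, mul_zero, h00, this, zero_sub, abs_neg]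
    rw [abs_of_nonneg (mul_nonneg hs.1 dist_nonneg)]
  rcases eq_or_ne x z with rfl | hxz
  · have h00 : γ₂ 0 = γ₁ 0 := h₂.1.trans h₁.1.symm
    have := h₁.2.2 (s * dist x y)
      ⟨mul_nonneg hs.1 dist_nonneg, mul_le_of_le_one_left dist_nonneg hs.2⟩ 0
      ⟨le_rfl, dist_nonneg⟩
    simp only [dist_self, mul_zero, h00, this, sub_zero]
    rw [abs_of_nonneg (mul_nonneg hs.1 dist_nonneg), dist_comm]
  have hy : 0 < dist x y := dist_pos.2 hxy
  have hz : 0 < dist x z := dist_pos.2 hxz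
  obtain ⟨x', y', z', hxy', hxz', hyz'⟩ := exists_comparison_triangle (a := dist x y)
    (b := dist x z) (c := dist y z) hy dist_nonneg dist_nonneg
    (by linarith [dist_triangle x z y, dist_comm y z])
    (dist_triangle x y z) (by linarith [dist_triangle y x z, dist_comm y x])
  refine (hX.2 x y z γ₁ γ₂ h₁ h₂ x' y' z' hxy' hxz' hyz' _
    ⟨mul_nonneg hs.1 dist_nonneg, mul_le_of_le_one_left dist_nonneg hs.2⟩ _
    ⟨mul_nonneg hs.1 dist_nonneg, mul_le_of_le_one_left dist_nonneg hs.2⟩).trans ?_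
  rw [cmpPoint, cmpPoint, mul_div_cancel_right₀ _ hy.ne', mul_div_cancel_right₀ _ hz.ne',
    dist_add_left, dist_smul₀, dist_sub_right, hyz', Real.norm_of_nonneg hs.1]

/-- Convexity of the distance function along two geodesics. -/
theorem IsCAT0.dist_geodesic_le (hX : IsCAT0 X) {x y x' y' : X} {γ γ' : ℝ → X}
    (h : IsGeodesic x y γ) (h' : IsGeodesic x' y' γ') {s : ℝ} (hs : s ∈ Set.Icc (0 : ℝ) 1) :
    dist (γ (s * dist x y)) (γ' (s * dist x' y')) ≤ (1 - s) * dist x x' + s * dist y y' := by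
  obtain ⟨σ, hσ⟩ := hX.1 x y'
  have h1 := hX.dist_geodesic_le_of_common_start h hσ hs
  have h2 := hX.dist_geodesic_le_of_common_start hσ.reverse h'.reverse (s := 1 - s)
    ⟨by linarith [hs.2], by linarith [hs.1]⟩
  rw [dist_comm y' x, dist_comm y' x', show dist x y' - (1 - s) * dist x y' = s * dist x y' by ring,
    show dist x' y' - (1 - s) * dist x' y' = s * dist x' y' by ring] at h2
  linarith [dist_triangle (γ (s * dist x y)) (σ (s * dist x y')) (γ' (s * dist x' y'))]

theorem IsCAT0.exists_midpoint_cn (hX : IsCAT0 X) (y z : X) :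
    ∃ m, dist y m = dist y z / 2 ∧ dist m z = dist y z / 2 ∧
      ∀ p, dist p m ^ 2 ≤ dist p y ^ 2 / 2 + dist p z ^ 2 / 2 - dist y z ^ 2 / 4 := by
  rcases eq_or_ne y z with rfl | hyz
  · exact ⟨y, by simp, by simp, fun p => le_of_eq (by simp)⟩
  have hd : 0 < dist y z := dist_pos.2 hyz
  have hmem : dist y z / 2 ∈ Set.Icc (0 : ℝ) (dist y z) := ⟨by linarith, by linarith⟩
  obtain ⟨γ, hγ⟩ := hX.1 y z
  refine ⟨γ (dist y z / 2), ?_, ?_, fun p => ?_⟩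
  · have := hγ.2.2 0 ⟨le_rfl, hd.le⟩ _ hmem
    rwa [hγ.1, zero_sub, abs_neg, abs_of_nonneg hmem.1] at this
  · have := hγ.2.2 _ hmem (dist y z) ⟨hd.le, le_rfl⟩
    rw [hγ.2.1] at this
    rw [this, abs_of_nonpos (by linarith)]; ring
  obtain ⟨y', z', p', hyz', hyp', hzp'⟩ := exists_comparison_triangle (a := dist y z)
    (b := dist y p) (c := dist z p) hd dist_nonneg dist_nonneg
    (by linarith [dist_triangle y p z, dist_comm z p])
    (dist_triangle y z p) (by linarith [dist_triangle z y p, dist_comm y z])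
  obtain ⟨σ, hσ⟩ := hX.1 y p
  have key := hX.2 y z p γ σ hγ hσ y' z' p' hyz' hyp' hzp' _ hmem (dist y p)
    ⟨dist_nonneg, le_rfl⟩
  rw [hσ.2.1] at key
  have hp : cmpPoint (dist y p) y' p' (dist y p) = p' := by
    rcases eq_or_ne y p with rfl | hyp
    · rw [dist_self, dist_eq_zero] at hyp'
      simp [cmpPoint, hyp']
    · simp [cmpPoint, div_self (dist_pos.2 hyp).ne']
  have hm : cmpPoint (dist y z) y' z' (dist y z / 2) = midpoint ℝ y' z' := by
    rw [cmpPoint, div_right_comm, div_self hd.ne', midpoint_eq_smul_add, invOf_eq_inv]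
    module
  rw [hp, hm, dist_comm] at key
  have hap := EuclideanGeometry.dist_sq_add_dist_sq_eq_two_mul_dist_midpoint_sq_add_half_dist_sq
    p' y' z'
  rw [dist_comm p' y', dist_comm p' z', hyp', hzp', hyz'] at hap
  have := pow_le_pow_left₀ dist_nonneg key 2
  rw [dist_comm (midpoint ℝ y' z')] at this
  rw [dist_comm p y, dist_comm p z]
  linarith

/-- The Bruhat-Tits inequality at any midpoint. -/
theorem IsCAT0.cn (hX : IsCAT0 X) {y z m : X} (h₁ : dist y m = dist y z / 2)
    (h₂ : dist m z = dist y z / 2) (p : X) :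
    dist p m ^ 2 ≤ dist p y ^ 2 / 2 + dist p z ^ 2 / 2 - dist y z ^ 2 / 4 := by
  obtain ⟨m', -, -, h⟩ := hX.exists_midpoint_cn y z
  have hm := h m
  rw [dist_comm m y, h₁, h₂] at hm
  have : dist m m' = 0 := by nlinarith [sq_nonneg (dist m m')]
  rw [dist_eq_zero.1 this]
  exact h p

/-- The Berg-Nikolaev quadrilateral inequality. -/
theorem IsCAT0.quadrilateral (hX : IsCAT0 X) (x y z w : X) :
    dist x z ^ 2 + dist y w ^ 2 ≤
      dist x y ^ 2 + dist y z ^ 2 + dist z w ^ 2 + dist w x ^ 2 := by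
  obtain ⟨m, -, -, h⟩ := hX.exists_midpoint_cn x z
  have h1 := h y
  have h2 := h w
  have h3 : dist y w ≤ dist y m + dist w m := dist_triangle_right y w m
  have h4 : dist y w ^ 2 ≤ (dist y m + dist w m) ^ 2 := pow_le_pow_left₀ dist_nonneg h3 2
  rw [dist_comm x y, dist_comm z w]
  nlinarith [sq_nonneg (dist y m - dist w m)]

end CAT0Basics

section JensenLemmas

/-- A continuous function satisfying Jensen's functional equation is affine. -/
theorem exists_affine_of_jensen {G : ℝ → ℝ} (hG : Continuous G)
    (h : ∀ a s, G (a + s) + G (a - s) = 2 * G a) : ∃ A B, ∀ a, G a = A * a + B := by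
  let ψ : ℝ →+ ℝ :=
    { toFun := fun a => G a - G 0
      map_zero' := sub_self _
      map_add' := fun x y => by
        have h1 := h ((x + y) / 2) ((x - y) / 2)
        have h2 := h ((x + y) / 2) ((x + y) / 2)
        rw [show (x + y) / 2 + (x - y) / 2 = x by ring,
          show (x + y) / 2 - (x - y) / 2 = y by ring] at h1
        rw [show (x + y) / 2 + (x + y) / 2 = x + y by ring, sub_self] at h2
        linarith }
  have hψ : Continuous ψ := hG.sub continuous_const
  refine ⟨ψ 1, G 0, fun a => ?_⟩
  have h1 := map_real_smul ψ hψ a 1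
  rw [smul_eq_mul, smul_eq_mul, mul_one] at h1
  rw [mul_comm, ← h1]
  exact (sub_add_cancel (G a) (G 0)).symm

/-- A midpoint-convex function on the line that is bounded above is constant. -/
theorem eq_of_midpoint_convex_of_bddAbove {F : ℝ → ℝ} {C : ℝ} (hC : ∀ a, F a ≤ C)
    (h : ∀ a s, 2 * F a ≤ F (a + s) + F (a - s)) (a b : ℝ) : F a = F b := by
  suffices H : ∀ a u, F (a + u) ≤ F a by
    refine le_antisymm ?_ ?_
    · simpa using H b (a - b)
    · simpa using H a (b - a)
  intro a u
  by_contra! hlt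
  have hstep : ∀ k : ℕ, F (a + u) - F a ≤ F (a + (k + 1 : ℕ) * u) - F (a + k * u) := by
    intro k
    induction k with
    | zero => simp
    | succ k ih =>
      have h1 := h (a + (k + 1 : ℕ) * u) u
      rw [show a + (k + 1 : ℕ) * u + u = a + (k + 1 + 1 : ℕ) * u by push_cast; ring,
        show a + (k + 1 : ℕ) * u - u = a + (k : ℕ) * u by push_cast; ring] at h1
      linarith
  have hsum : ∀ k : ℕ, k * (F (a + u) - F a) ≤ F (a + k * u) - F a := by
    intro k
    induction k with
    | zero => simp
    | succ k ih =>
      have h1 := hstep k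
      push_cast at h1 ⊢
      linarith
  obtain ⟨k, hk⟩ := exists_nat_gt ((C - F a) / (F (a + u) - F a))
  rw [div_lt_iff₀ (by linarith)] at hk
  linarith [hsum k, hC (a + k * u)]

end JensenLemmas

section Lines

variable {X : Type*} [MetricSpace X]

/-- `c` is a unit speed geodesic line along which `f` translates by `L`. -/
structure IsTransLine (f : X → X) (L : ℝ) (c : ℝ → X) : Prop where
  dist_eq : ∀ s t, dist (c s) (c t) = |s - t|
  map_eq : ∀ t, f (c t) = c (t + L)

theorem IsTransLine.continuous {f : X → X} {L : ℝ} {c : ℝ → X} (hc : IsTransLine f L c) :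
    Continuous c :=
  (Isometry.of_dist_eq fun s t => by rw [hc.dist_eq, Real.dist_eq]).continuous

theorem IsTransLine.shift {f : X → X} {L : ℝ} {c : ℝ → X} (hc : IsTransLine f L c) (a : ℝ) :
    IsTransLine f L fun t => c (t + a) :=
  ⟨fun s t => by rw [hc.dist_eq]; congr 1; ring, fun t => by rw [hc.map_eq]; congr 1; ring⟩

theorem IsTransLine.comp {f h : X → X} {L : ℝ} {c : ℝ → X} (hc : IsTransLine f L c)
    (hh : Isometry h) (hcomm : ∀ x, f (h x) = h (f x)) : IsTransLine f L fun t => h (c t) :=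
  ⟨fun s t => by rw [hh.dist_eq, hc.dist_eq], fun t => by rw [hcomm, hc.map_eq]⟩

theorem isGeodesic_of_dist_eq {c : ℝ → X} (hc : ∀ s t, dist (c s) (c t) = |s - t|) {p q : ℝ}
    (hpq : p ≤ q) : IsGeodesic (c p) (c q) fun r => c (p + r) := by
  have hd : dist (c p) (c q) = q - p := by rw [hc, abs_sub_comm, abs_of_nonneg (by linarith)]
  refine ⟨by simp, by simp [hd], fun s _ t _ => ?_⟩
  rw [hc]; congr 1; ring

theorem IsCAT0.convexOn_dist (hX : IsCAT0 X) {c c' : ℝ → X}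
    (hc : ∀ s t, dist (c s) (c t) = |s - t|) (hc' : ∀ s t, dist (c' s) (c' t) = |s - t|) :
    ConvexOn ℝ Set.univ fun t => dist (c t) (c' t) := by
  refine LinearOrder.convexOn_of_lt convex_univ fun p _ q _ hpq a b ha hb hab => ?_
  have h := hX.dist_geodesic_le (isGeodesic_of_dist_eq hc hpq.le) (isGeodesic_of_dist_eq hc' hpq.le)
    (s := b) ⟨hb.le, by linarith⟩
  rw [hc, hc', abs_sub_comm, abs_of_nonneg (by linarith)] at h
  have ha' : a = 1 - b := by linarith
  subst ha'
  simp only [smul_eq_mul]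
  rwa [show (1 - b) * p + b * q = p + b * (q - p) by ring]

variable {f : X → X} {L : ℝ} {c c' : ℝ → X}

/-- Two lines translated equally by one isometry are parallel. -/
theorem IsCAT0.dist_transLine_eq (hX : IsCAT0 X) (hf : Isometry f) (hL : 0 < L)
    (hc : IsTransLine f L c) (hc' : IsTransLine f L c') (s s' : ℝ) :
    dist (c s) (c' s) = dist (c s') (c' s') := by
  have hper : Function.Periodic (fun t => dist (c t) (c' t)) L := fun t => by
    simp only [← hc.map_eq, ← hc'.map_eq, hf.dist_eq]
  refine eq_of_midpoint_convex_of_bddAbove (F := fun t => dist (c t) (c' t))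
    (C := dist (c 0) (c' 0) + 2 * L) (fun a => ?_) (fun a u => ?_) s s'
  · obtain ⟨y, hy, hay⟩ := hper.exists_mem_Ico₀ hL a
    refine hay.trans_le ?_
    have h1 := dist_triangle4 (c y) (c 0) (c' 0) (c' y)
    rw [hc.dist_eq, hc'.dist_eq, sub_zero, zero_sub, abs_neg, abs_of_nonneg hy.1] at h1
    linarith [hy.2]
  · have h := (hX.convexOn_dist hc.dist_eq hc'.dist_eq).2 (Set.mem_univ (a + u))
      (Set.mem_univ (a - u)) (show (0 : ℝ) ≤ 1 / 2 by norm_num) (show (0 : ℝ) ≤ 1 / 2 by norm_num)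
      (by norm_num)
    simp only [smul_eq_mul] at h
    rw [show 1 / 2 * (a + u) + 1 / 2 * (a - u) = a by ring] at h
    linarith

theorem IsCAT0.transLine_unique (hX : IsCAT0 X) (hf : Isometry f) (hL : 0 < L)
    (hc : IsTransLine f L c) (hc' : IsTransLine f L c') {a : ℝ} (h : c a = c' a) (t : ℝ) :
    c t = c' t := by
  rw [← dist_eq_zero, hX.dist_transLine_eq hf hL hc hc' t a, h, dist_self]

/-- The flat strip theorem: two lines translated equally by one isometry bound a flat strip,
so that squared distances between their points are quadratic. -/
theorem IsCAT0.exists_dist_sq_transLine (hX : IsCAT0 X) (hf : Isometry f) (hL : 0 < L)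
    (hc : IsTransLine f L c) (hc' : IsTransLine f L c') :
    ∃ A B, ∀ s t, dist (c s) (c' t) ^ 2 = (s - t) ^ 2 + A * (s - t) + B := by
  have hdiag : ∀ s t, dist (c s) (c' t) = dist (c 0) (c' (t - s)) := fun s t => by
    simpa using hX.dist_transLine_eq hf hL hc (hc'.shift (t - s)) s 0
  obtain ⟨A, B, hAB⟩ := exists_affine_of_jensen (G := fun a => dist (c 0) (c' a) ^ 2 - a ^ 2)
    (((continuous_const.dist hc'.continuous).pow 2).sub (continuous_pow 2)) (fun a s => by
      refine le_antisymm ?_ ?_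
      · have h := hX.quadrilateral (c 0) (c s) (c' (a + s)) (c' a)
        rw [dist_comm (c' a) (c 0), hdiag s (a + s), hdiag s a, hc.dist_eq, hc'.dist_eq] at h
        simp only [zero_sub, abs_neg, add_sub_cancel_left, add_sub_cancel_right, sq_abs] at h
        nlinarith
      · have hd : dist (c' (a - s)) (c' (a + s)) = 2 * |s| := by
          rw [hc'.dist_eq, abs_sub_comm, show a + s - (a - s) = 2 * s by ring, abs_mul]; simp
        have h := hX.cn (y := c' (a - s)) (z := c' (a + s)) (m := c' a)
          (by rw [hd, hc'.dist_eq, abs_sub_comm]; simp) (by rw [hd, hc'.dist_eq]; simp) (c 0)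
        rw [hd, mul_pow, sq_abs] at h
        nlinarith)
  refine ⟨-A, B, fun s t => ?_⟩
  have := hAB (t - s)
  rw [hdiag]
  linarith

end Lines

section Axes

variable {X : Type*} [MetricSpace X]

theorem transLen_le (f : X → X) (x : X) : transLen f ≤ dist x (f x) :=
  csInf_le ⟨0, by rintro _ ⟨y, rfl⟩; exact dist_nonneg⟩ ⟨x, rfl⟩

theorem IsCAT0.two_mul_le_dist_sq (hX : IsCAT0 X) {f : X ≃ᵢ X} {L : ℝ}
    (hL : ∀ x, L ≤ dist x (f x)) (x : X) : 2 * L ≤ dist x ((f ^ 2 : X ≃ᵢ X) x) := by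
  rw [pow_two, IsometryEquiv.mul_apply]
  obtain ⟨γ, hγ⟩ := hX.1 x (f x)
  have hfγ : IsGeodesic (f x) (f (f x)) (f ∘ γ) := hγ.comp_isometry f.isometry
  have h := hX.dist_geodesic_le_of_common_start hγ.reverse hfγ (s := 1 / 2) (by norm_num)
  have hmid : dist x (f x) - 1 / 2 * dist (f x) x = 1 / 2 * dist (f x) (f (f x)) := by
    rw [f.isometry.dist_eq, dist_comm (f x) x]; ring
  simp only [hmid, Function.comp] at h
  linarith [hL (γ (1 / 2 * dist (f x) (f (f x))))]

theorem IsCAT0.dist_iterate (hX : IsCAT0 X) {f : X ≃ᵢ X} {x : X} (hx : x ∈ MinSet f) (n : ℕ) :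
    dist x ((f ^ n : X ≃ᵢ X) x) = n * transLen f := by
  have hle : ∀ (m : ℕ) (y : X), dist y (f y) = transLen f →
      dist y ((f ^ m : X ≃ᵢ X) y) ≤ m * transLen f := by
    intro m y hy
    induction m with
    | zero => simp
    | succ m ih =>
      rw [pow_succ, IsometryEquiv.mul_apply]
      have h1 := dist_triangle y ((f ^ m : X ≃ᵢ X) y) ((f ^ m : X ≃ᵢ X) (f y))
      rw [(f ^ m : X ≃ᵢ X).isometry.dist_eq, hy] at h1
      push_cast
      linarith
  have hge : ∀ (k : ℕ) (y : X), 2 ^ k * transLen f ≤ dist y ((f ^ 2 ^ k : X ≃ᵢ X) y) := by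
    intro k
    induction k with
    | zero => simpa using transLen_le f
    | succ k ih =>
      intro y
      have := hX.two_mul_le_dist_sq ih y
      rw [← pow_mul, ← pow_succ] at this
      rw [pow_succ]
      linarith
  refine le_antisymm (hle n x hx) ?_
  have hn : n ≤ 2 ^ n := Nat.lt_two_pow_self.le
  have h1 := hge n x
  have h2 := hle (2 ^ n - n) x hx
  have h3 := dist_triangle x ((f ^ n : X ≃ᵢ X) x) ((f ^ 2 ^ n : X ≃ᵢ X) x)
  rw [show (f ^ 2 ^ n : X ≃ᵢ X) x = (f ^ n : X ≃ᵢ X) ((f ^ (2 ^ n - n) : X ≃ᵢ X) x) by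
    rw [← IsometryEquiv.mul_apply, ← pow_add, Nat.add_sub_cancel' hn]] at h1 h3
  rw [(f ^ n : X ≃ᵢ X).isometry.dist_eq] at h3
  push_cast [hn] at h2
  linarith

/-- Through every point of the minset of a hyperbolic isometry passes an axis. -/
theorem IsCAT0.exists_axis (hX : IsCAT0 X) {f : X ≃ᵢ X} (hL : 0 < transLen f) {x : X}
    (hx : x ∈ MinSet f) : ∃ c : ℝ → X, c 0 = x ∧ IsTransLine f (transLen f) c := by
  obtain ⟨γ, hγ0, hγ1, hγ⟩ := hX.1 x (f x)
  set L := transLen f with hLdef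
  have hxL : dist x (f x) = L := hx
  rw [hxL] at hγ1 hγ
  let V : ℤ → X := fun n => (f ^ n : X ≃ᵢ X) x
  have hV : ∀ m n : ℤ, m ≤ n → dist (V m) (V n) = (n - m) * L := by
    intro m n hmn
    obtain ⟨k, rfl⟩ := Int.le.dest hmn
    simp only [V, zpow_add, IsometryEquiv.mul_apply, (f ^ m : X ≃ᵢ X).isometry.dist_eq,
      zpow_natCast]
    rw [hX.dist_iterate hx]
    push_cast; ring
  let c : ℝ → X := fun t => (f ^ ⌊t / L⌋ : X ≃ᵢ X) (γ (t - ⌊t / L⌋ * L))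
  have hfl : ∀ t : ℝ, (⌊t / L⌋ : ℝ) * L ≤ t ∧ t < (⌊t / L⌋ + 1) * L := fun t =>
    ⟨by rw [← le_div_iff₀ hL]; exact Int.floor_le _,
      by rw [← div_lt_iff₀ hL]; exact Int.lt_floor_add_one _⟩
  have hmem : ∀ t : ℝ, t - ⌊t / L⌋ * L ∈ Set.Icc (0 : ℝ) L := fun t =>
    ⟨by linarith [hfl t], by linarith [hfl t]⟩
  have hlo : ∀ t : ℝ, dist (V ⌊t / L⌋) (c t) = t - ⌊t / L⌋ * L := by
    intro t
    have := hγ 0 ⟨le_rfl, hL.le⟩ _ (hmem t)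
    simp only [V, c, (f ^ ⌊t / L⌋ : X ≃ᵢ X).isometry.dist_eq]
    rw [← hγ0, this, zero_sub, abs_neg, abs_of_nonneg (hmem t).1]
  have hhi : ∀ t : ℝ, dist (c t) (V (⌊t / L⌋ + 1)) = (⌊t / L⌋ + 1) * L - t := by
    intro t
    have := hγ _ (hmem t) L ⟨hL.le, le_rfl⟩
    simp only [V, c, zpow_add, zpow_one, IsometryEquiv.mul_apply,
      (f ^ ⌊t / L⌋ : X ≃ᵢ X).isometry.dist_eq]
    rw [← hγ1, this, abs_of_nonpos (by linarith [(hmem t).2])]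
    ring
  have hle : ∀ s t : ℝ, s ≤ t → dist (c s) (c t) = t - s := by
    intro s t hst
    have hfloor : ⌊s / L⌋ ≤ ⌊t / L⌋ := Int.floor_mono (by gcongr)
    rcases hfloor.eq_or_lt with heq | hlt
    · have := hγ _ (hmem s) _ (hmem t)
      simp only [c]
      rw [← heq] at this ⊢
      rw [(f ^ ⌊s / L⌋ : X ≃ᵢ X).isometry.dist_eq, this, abs_of_nonpos (by linarith)]
      ring
    · refine le_antisymm ?_ ?_
      · have h1 := dist_triangle4 (c s) (V (⌊s / L⌋ + 1)) (V ⌊t / L⌋) (c t)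
        rw [hhi, hlo, hV _ _ (by omega)] at h1
        push_cast at h1
        linarith
      · have h1 := dist_triangle4 (V ⌊s / L⌋) (c s) (c t) (V (⌊t / L⌋ + 1))
        rw [hhi, hlo, hV _ _ (by omega)] at h1
        push_cast at h1
        linarith
  refine ⟨c, by simp [c, hγ0], fun s t => ?_, fun t => ?_⟩
  · rcases le_total s t with h | h
    · rw [hle s t h, abs_sub_comm, abs_of_nonneg (by linarith)]
    · rw [dist_comm, hle t s h, abs_of_nonneg (by linarith)]
  · have : (t + L) / L = t / L + 1 := by field_simp
    simp only [c, this, Int.floor_add_one]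
    rw [add_comm ⌊t / L⌋, zpow_add, zpow_one, IsometryEquiv.mul_apply]
    congr 3
    push_cast; ring

end Axes

section Grids

variable {X : Type*} [MetricSpace X]

/-- `P` is foliated by lines translated by `h` in the first direction and by lines translated
by `g` in the second direction. -/
structure IsGrid (h g : X → X) (lh lg : ℝ) (P : ℝ → ℝ → X) : Prop where
  fst : ∀ t, IsTransLine h lh fun u => P u t
  snd : ∀ u, IsTransLine g lg (P u)

variable {h g : X ≃ᵢ X} {lh lg : ℝ} {P P' : ℝ → ℝ → X}

theorem IsGrid.shift {h g : X → X} (hP : IsGrid h g lh lg P) (a b : ℝ) :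
    IsGrid h g lh lg fun u t => P (u + a) (t + b) :=
  ⟨fun t => (hP.fst (t + b)).shift a, fun u => (hP.snd (u + a)).shift b⟩

/-- A point in the minsets of two commuting hyperbolic isometries lies on a grid. -/
theorem IsCAT0.exists_grid (hX : IsCAT0 X) (hcomm : ∀ x, g (h x) = h (g x))
    (hh : 0 < transLen h) (hg : 0 < transLen g) {x : X} (hxh : x ∈ MinSet h) (hxg : x ∈ MinSet g) :
    ∃ P : ℝ → ℝ → X, P 0 0 = x ∧ IsGrid h g (transLen h) (transLen g) P := by
  obtain ⟨e, he0, he⟩ := hX.exists_axis hh hxh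
  have hge : IsTransLine h (transLen h) fun t => g (e t) :=
    he.comp g.isometry fun x => (hcomm x).symm
  have hmem : ∀ u, e u ∈ MinSet g := fun u =>
    (hX.dist_transLine_eq h.isometry hh he hge u 0).trans (by rw [he0]; exact hxg)
  choose P hP0 hP using fun u => hX.exists_axis hg (hmem u)
  refine ⟨P, by rw [hP0, he0], ⟨fun t => ⟨fun u v => ?_, fun u => ?_⟩, hP⟩⟩
  · rw [hX.dist_transLine_eq g.isometry hg (hP u) (hP v) t 0, hP0, hP0, he.dist_eq]
  · refine hX.transLine_unique g.isometry hg ((hP u).comp h.isometry hcomm)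
      (hP (u + transLen h)) (a := 0) ?_ t
    simp only [hP0, he.map_eq]

/-- Squared distances between points of two grids are quadratic in the coordinates. -/
theorem IsCAT0.exists_dist_sq_grid (hX : IsCAT0 X) (hh : 0 < lh) (hg : 0 < lg)
    (hP : IsGrid h g lh lg P) (hP' : IsGrid h g lh lg P') :
    ∃ α β γ δ, ∀ u t u' t', dist (P u t) (P' u' t') ^ 2 =
      (u - u') ^ 2 + (t - t') ^ 2 + δ * (u - u') * (t - t') + β * (u - u') + γ * (t - t') + α := by
  have hdiag : ∀ u t u' t', dist (P u t) (P' u' t') = dist (P (u - u') (t - t')) (P' 0 0) := by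
    intro u t u' t'
    have h1 := hX.dist_transLine_eq g.isometry hg ((hP.snd u).shift (t - t')) (hP'.snd u') t' 0
    have h2 := hX.dist_transLine_eq h.isometry hh ((hP.fst (t - t')).shift (u - u')) (hP'.fst 0)
      u' 0
    simp only [add_sub_cancel, zero_add] at h1 h2
    rw [h1, h2]
  choose A B hAB using fun u =>
    hX.exists_dist_sq_transLine g.isometry hg (hP.snd u) (hP'.snd 0)
  choose A' B' hAB' using fun t =>
    hX.exists_dist_sq_transLine h.isometry hh (hP.fst t) (hP'.fst 0)
  have hA : ∀ u t, t ^ 2 + A u * t + B u = u ^ 2 + A' t * u + B' t := fun u t => by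
    have h1 := hAB u t 0
    have h2 := hAB' t u 0
    simp only [sub_zero] at h1 h2
    rw [← h1, ← h2]
  refine ⟨B' 0, A' 0, B' 1 - B' 0 - 1, A' 1 - A' 0, fun u t u' t' => ?_⟩
  have h1 := hAB (u - u') (t - t') 0
  rw [sub_zero] at h1
  rw [hdiag, h1]
  linear_combination (1 - (t - t')) * hA (u - u') 0 + (t - t') * hA (u - u') 1

theorem IsCAT0.exists_dist_sq_self_grid (hX : IsCAT0 X) (hh : 0 < lh) (hg : 0 < lg)
    (hP : IsGrid h g lh lg P) : ∃ δ, ∀ u t u' t', dist (P u t) (P u' t') ^ 2 =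
      (u - u') ^ 2 + (t - t') ^ 2 + δ * (u - u') * (t - t') := by
  obtain ⟨α, β, γ, δ, H⟩ := hX.exists_dist_sq_grid hh hg hP hP
  have h0 := H 0 0 0 0
  have h1 := H 1 0 0 0
  have h2 := H 0 1 0 0
  rw [(hP.fst 0).dist_eq] at h1
  rw [(hP.snd 0).dist_eq] at h2
  simp at h0 h1 h2
  refine ⟨δ, fun u t u' t' => ?_⟩
  rw [H]
  subst h0
  have hβ : β = 0 := by linarith
  have hγ : γ = 0 := by linarith
  rw [hβ, hγ]; ring

end Grids

section ProperlyDiscontinuous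

variable {G X : Type*} [Group G] [MetricSpace X] {φ : G →* (X ≃ᵢ X)}

theorem map_zpow_apply_of_translation {V : Type*} [AddCommGroup V] {g : G} {Q : V → X} {v : V}
    (hQ : ∀ p, φ g (Q p) = Q (p + v)) (n : ℤ) (p : V) : φ (g ^ n) (Q p) = Q (p + n • v) := by
  induction n generalizing p with
  | zero => simp
  | succ n ih =>
    rw [zpow_add_one, map_mul, IsometryEquiv.mul_apply, hQ, ih, add_assoc, add_smul, one_smul,
      add_comm v]
  | pred n ih =>
    have := hQ (p - v)
    rw [sub_add_cancel] at this
    rw [zpow_sub_one, map_mul, IsometryEquiv.mul_apply, ← this, map_inv,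
      IsometryEquiv.inv_apply_self, ih, sub_smul, one_smul]
    congr 1; abel

/-- A sequence of group elements returning a point to a compact set repeats. -/
theorem ProperlyDisc.exists_ne_eq (hpd : ProperlyDisc φ) {K : Set X} (hK : IsCompact K) {x : X}
    (hx : x ∈ K) {F : ℕ → G} (hF : ∀ n, φ (F n) x ∈ K) : ∃ m n, m < n ∧ F m = F n := by
  have hfin := hpd K hK
  exact hfin.exists_lt_map_eq_of_forall_mem (f := F)
    fun n => Set.mem_ofPred.2 ⟨φ (F n) x, ⟨x, hx, rfl⟩, hF n⟩

theorem ProperlyDisc.transLen_pos (hpd : ProperlyDisc φ) {g : G}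
    (hg : ∀ k : ℤ, k ≠ 0 → g ^ k ≠ 1) {x : X} (hx : x ∈ MinSet (φ g)) : 0 < transLen (φ g) := by
  have hx' : dist x (φ g x) = transLen (φ g) := hx
  rcases (hx' ▸ dist_nonneg : 0 ≤ transLen (φ g)).eq_or_lt with h0 | h0
  swap
  · exact h0
  have hfix : φ g x = x := (dist_eq_zero.1 (hx'.trans h0.symm)).symm
  obtain ⟨m, n, hmn, h⟩ := hpd.exists_ne_eq (isCompact_singleton (x := x)) rfl
    (F := fun n => g ^ n) fun n => by
      induction n with
      | zero => simp
      | succ n ih =>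
        rw [Set.mem_singleton_iff] at ih ⊢
        rw [pow_succ, map_mul, IsometryEquiv.mul_apply, hfix, ih]
  refine absurd ?_ (hg (n - m : ℤ) (by omega))
  rw [zpow_sub, zpow_natCast, zpow_natCast]
  rw [← h, mul_inv_cancel]

/-- Rank two abelian groups generated by hyperbolic isometries have non-degenerate grids. -/
theorem ProperlyDisc.grid_nondegenerate (hpd : ProperlyDisc φ) {h g : G}
    (hfree : ∀ i j : ℤ, h ^ i * g ^ j = 1 → i = 0 ∧ j = 0) {lh lg : ℝ} (hlg : 0 < lg)
    {P : ℝ → ℝ → X} (hP : IsGrid (φ h) (φ g) lh lg P) {δ : ℝ}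
    (hδ : ∀ u t u' t', dist (P u t) (P u' t') ^ 2 =
      (u - u') ^ 2 + (t - t') ^ 2 + δ * (u - u') * (t - t')) : δ ^ 2 < 4 := by
  have hle : δ ^ 2 ≤ 4 := by
    have := hδ (-δ) 2 0 0
    nlinarith [sq_nonneg (dist (P (-δ) 2) (P 0 0))]
  refine lt_of_le_of_ne hle fun h4 => ?_
  obtain ⟨ε, rfl⟩ : ∃ ε, δ = 2 * ε := ⟨δ / 2, by ring⟩
  have hε : ε ^ 2 = 1 := by linarith
  have hline : ∀ u t, P u t = P 0 (t + ε * u) := fun u t => by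
    rw [← dist_eq_zero, ← sq_eq_zero_iff, hδ]
    linear_combination (-u ^ 2) * hε
  have hgz : ∀ (n : ℤ) u t, φ (g ^ n) (P u t) = P u (t + n * lg) := fun n u t => by
    rw [map_zpow_apply_of_translation (hP.snd u).map_eq, zsmul_eq_mul]
  have hhz : ∀ (n : ℕ) u t, φ (h ^ n) (P u t) = P (u + n * lh) t := fun n u t => by
    have := map_zpow_apply_of_translation (hP.fst t).map_eq n u
    rwa [zpow_natCast, zsmul_eq_mul] at this
  obtain ⟨m, n, hmn, heq⟩ := hpd.exists_ne_eq (K := P 0 '' Set.Icc 0 lg) (x := P 0 0)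
    (isCompact_Icc.image (hP.snd 0).continuous) ⟨0, ⟨le_rfl, hlg.le⟩, rfl⟩
    (F := fun n : ℕ => g ^ (-⌊ε * (n * lh) / lg⌋) * h ^ n) fun n => by
      rw [map_mul, IsometryEquiv.mul_apply, hhz, hline, hgz]
      refine ⟨_, ⟨?_, ?_⟩, rfl⟩
      · have := Int.floor_le (ε * (n * lh) / lg)
        rw [le_div_iff₀ hlg] at this
        push_cast; linarith
      · have := (Int.lt_floor_add_one (ε * (n * lh) / lg)).le
        rw [div_le_iff₀ hlg] at this
        push_cast; linarith
  generalize -⌊ε * (m * lh) / lg⌋ = a at heq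
  generalize -⌊ε * (n * lh) / lg⌋ = b at heq
  have := hfree (n - m : ℤ) (b - a) ?_
  · omega
  · have hz : h ^ (n - m : ℤ) = g ^ (a - b) := by
      rw [zpow_sub, sub_eq_neg_add, zpow_add, zpow_neg, zpow_natCast, zpow_natCast,
        mul_inv_eq_iff_eq_mul, mul_assoc, heq, inv_mul_cancel_left]
    rw [hz, ← zpow_add]; simp

end ProperlyDiscontinuous

section CubicalSperner

/-- The signed indicator of the labels `0, 1`. -/
def spernerEdge (a b : Fin 4) : ℤ :=
  if a = 0 ∧ b = 1 then 1 else if a = 1 ∧ b = 0 then -1 else 0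

/-- The signed indicator of the labels `0, 1, 2`. -/
def spernerTriangle (a b c : Fin 4) : ℤ :=
  if a = 2 then spernerEdge b c else if b = 2 then -spernerEdge a c
    else if c = 2 then spernerEdge a b else 0

/-- The boundary of `spernerTriangle`, a signed indicator of all four labels. -/
def spernerTetrahedron (a b c d : Fin 4) : ℤ :=
  spernerTriangle b c d - spernerTriangle a c d + spernerTriangle a b d - spernerTriangle a b c

theorem exists_eq_of_spernerTetrahedron_ne_zero : ∀ a b c d : Fin 4,
    spernerTetrahedron a b c d ≠ 0 → ∀ l, a = l ∨ b = l ∨ c = l ∨ d = l := by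
  decide

theorem exists_eq_of_spernerTriangle_ne_zero : ∀ a b c : Fin 4,
    spernerTriangle a b c ≠ 0 → ∀ l ≤ 2, a = l ∨ b = l ∨ c = l := by
  decide

theorem exists_eq_of_spernerEdge_ne_zero : ∀ a b : Fin 4,
    spernerEdge a b ≠ 0 → ∀ l ≤ 1, a = l ∨ b = l := by
  decide

theorem spernerTriangle_eq_of_le_two : ∀ a b c : Fin 4, a ≤ 2 → b ≤ 2 → c ≤ 2 →
    spernerTriangle a b c = spernerEdge b c - spernerEdge a c + spernerEdge a b := by
  decide

theorem spernerEdge_eq_of_le_one : ∀ a b : Fin 4, a ≤ 1 → b ≤ 1 →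
    spernerEdge a b = (if b = 0 then -1 else 0) - (if a = 0 then -1 else 0) := by
  decide

/-- Kuhn's cubical version of Sperner's lemma in the plane. -/
theorem sum_spernerTriangle_square (N : ℕ) (L : ℕ → ℕ → Fin 4)
    (h0 : ∀ j, L 0 j = 0) (h1 : ∀ i, L i 0 ≤ 1) (h2 : ∀ i j, L i j ≤ 2)
    (H0 : ∀ j, L N j ≠ 0) (H1 : ∀ i, L i N ≠ 1) :
    ∑ i ∈ Finset.range N, ∑ j ∈ Finset.range N,
      (spernerTriangle (L i j) (L (i + 1) j) (L (i + 1) (j + 1)) -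
        spernerTriangle (L i j) (L i (j + 1)) (L (i + 1) (j + 1))) = 1 := by
  have hz : ∀ {a b : Fin 4} (l : Fin 4), l ≤ 1 → a ≠ l → b ≠ l → spernerEdge a b = 0 :=
    fun {a b} l hl ha hb => by
      by_contra h
      exact (exists_eq_of_spernerEdge_ne_zero a b h l hl).elim ha hb
  have hy : ∑ j ∈ Finset.range N, ∑ i ∈ Finset.range N,
      (spernerEdge (L (i + 1) j) (L (i + 1) (j + 1)) - spernerEdge (L i j) (L i (j + 1))) = 0 := by
    refine Finset.sum_eq_zero fun j _ => ?_
    rw [Finset.sum_range_sub (fun i => spernerEdge (L i j) (L i (j + 1))),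
      hz 0 (by decide) (H0 _) (H0 _), hz 1 (by decide) (by simp [h0]) (by simp [h0]), sub_zero]
  have hx : ∑ i ∈ Finset.range N, ∑ j ∈ Finset.range N,
      (spernerEdge (L i (j + 1)) (L (i + 1) (j + 1)) - spernerEdge (L i j) (L (i + 1) j)) = -1 := by
    have : ∀ i ∈ Finset.range N, ∑ j ∈ Finset.range N,
        (spernerEdge (L i (j + 1)) (L (i + 1) (j + 1)) - spernerEdge (L i j) (L (i + 1) j)) =
        -((if L (i + 1) 0 = 0 then -1 else 0) - (if L i 0 = 0 then -1 else 0)) := fun i _ => by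
      rw [Finset.sum_range_sub (fun j => spernerEdge (L i j) (L (i + 1) j)),
        hz 1 (by decide) (H1 _) (H1 _), spernerEdge_eq_of_le_one _ _ (h1 _) (h1 _), zero_sub]
    rw [Finset.sum_congr rfl this, Finset.sum_neg_distrib,
      Finset.sum_range_sub (fun i => if L i 0 = 0 then (-1 : ℤ) else 0)]
    simp [h0, H0]
  rw [Finset.sum_comm] at hy
  have := congrArg₂ (· - ·) hy hx
  simp only [← Finset.sum_sub_distrib] at this
  rw [show (1 : ℤ) = 0 - -1 by norm_num, ← this]
  refine Finset.sum_congr rfl fun i _ => Finset.sum_congr rfl fun j _ => ?_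
  rw [spernerTriangle_eq_of_le_two _ _ _ (h2 _ _) (h2 _ _) (h2 _ _),
    spernerTriangle_eq_of_le_two _ _ _ (h2 _ _) (h2 _ _) (h2 _ _)]
  ring

/-- Kuhn's cubical version of Sperner's lemma in dimension three: some unit cube carries all
four labels. -/
theorem exists_rainbow_cube (N : ℕ) (L : ℕ → ℕ → ℕ → Fin 4)
    (h0 : ∀ j k, L 0 j k = 0) (h1 : ∀ i k, L i 0 k ≤ 1) (h2 : ∀ i j, L i j 0 ≤ 2)
    (H0 : ∀ j k, L N j k ≠ 0) (H1 : ∀ i k, L i N k ≠ 1) (H2 : ∀ i j, L i j N ≠ 2) :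
    ∃ i j k, ∀ l, ∃ a ≤ 1, ∃ b ≤ 1, ∃ c ≤ 1, L (i + a) (j + b) (k + c) = l := by
  by_contra! hno
  have hz : ∀ {a b c : Fin 4} (l : Fin 4), l ≤ 2 → a ≠ l → b ≠ l → c ≠ l →
      spernerTriangle a b c = 0 := fun {a b c} l hl ha hb hc => by
    by_contra h
    rcases exists_eq_of_spernerTriangle_ne_zero a b c h l hl with h | h | h <;> contradiction
  have hx : ∑ j ∈ Finset.range N, ∑ k ∈ Finset.range N, ∑ i ∈ Finset.range N,
      ((spernerTriangle (L (i + 1) j k) (L (i + 1) (j + 1) k) (L (i + 1) (j + 1) (k + 1)) -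
        spernerTriangle (L (i + 1) j k) (L (i + 1) j (k + 1)) (L (i + 1) (j + 1) (k + 1))) -
      (spernerTriangle (L i j k) (L i (j + 1) k) (L i (j + 1) (k + 1)) -
        spernerTriangle (L i j k) (L i j (k + 1)) (L i (j + 1) (k + 1)))) = 0 := by
    refine Finset.sum_eq_zero fun j _ => Finset.sum_eq_zero fun k _ => ?_
    rw [Finset.sum_range_sub (fun i =>
      spernerTriangle (L i j k) (L i (j + 1) k) (L i (j + 1) (k + 1)) -
        spernerTriangle (L i j k) (L i j (k + 1)) (L i (j + 1) (k + 1)))]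
    rw [hz 0 (by decide) (H0 _ _) (H0 _ _) (H0 _ _), hz 0 (by decide) (H0 _ _) (H0 _ _) (H0 _ _)]
    simp [h0, spernerTriangle]
  have hy : ∑ i ∈ Finset.range N, ∑ k ∈ Finset.range N, ∑ j ∈ Finset.range N,
      ((spernerTriangle (L i (j + 1) k) (L i (j + 1) (k + 1)) (L (i + 1) (j + 1) (k + 1)) -
        spernerTriangle (L i (j + 1) k) (L (i + 1) (j + 1) k) (L (i + 1) (j + 1) (k + 1))) -
      (spernerTriangle (L i j k) (L i j (k + 1)) (L (i + 1) j (k + 1)) -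
        spernerTriangle (L i j k) (L (i + 1) j k) (L (i + 1) j (k + 1)))) = 0 := by
    refine Finset.sum_eq_zero fun i _ => Finset.sum_eq_zero fun k _ => ?_
    rw [Finset.sum_range_sub (fun j =>
      spernerTriangle (L i j k) (L i j (k + 1)) (L (i + 1) j (k + 1)) -
        spernerTriangle (L i j k) (L (i + 1) j k) (L (i + 1) j (k + 1)))]
    have hne : ∀ i k, L i 0 k ≠ 2 := fun i k h => absurd (h1 i k) (by rw [h]; decide)
    simp [hz 1 (by decide) (H1 _ _) (H1 _ _) (H1 _ _),
      hz 2 le_rfl (hne _ _) (hne _ _) (hne _ _)]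
  have hzz : ∑ i ∈ Finset.range N, ∑ j ∈ Finset.range N, ∑ k ∈ Finset.range N,
      ((spernerTriangle (L i j (k + 1)) (L (i + 1) j (k + 1)) (L (i + 1) (j + 1) (k + 1)) -
        spernerTriangle (L i j (k + 1)) (L i (j + 1) (k + 1)) (L (i + 1) (j + 1) (k + 1))) -
      (spernerTriangle (L i j k) (L (i + 1) j k) (L (i + 1) (j + 1) k) -
        spernerTriangle (L i j k) (L i (j + 1) k) (L (i + 1) (j + 1) k))) = -1 := by
    rw [← sum_spernerTriangle_square N (fun i j => L i j 0) (fun j => h0 j 0) (fun i => h1 i 0) h2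
      (fun j => H0 j 0) (fun i => H1 i 0), ← Finset.sum_neg_distrib]
    refine Finset.sum_congr rfl fun i _ => ?_
    rw [← Finset.sum_neg_distrib]
    refine Finset.sum_congr rfl fun j _ => ?_
    rw [Finset.sum_range_sub (fun k =>
      spernerTriangle (L i j k) (L (i + 1) j k) (L (i + 1) (j + 1) k) -
        spernerTriangle (L i j k) (L i (j + 1) k) (L (i + 1) (j + 1) k))]
    simp [hz 2 le_rfl (H2 _ _) (H2 _ _) (H2 _ _)]
  rw [Finset.sum_congr rfl fun j _ => Finset.sum_comm, Finset.sum_comm] at hx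
  rw [Finset.sum_congr rfl fun i _ => Finset.sum_comm] at hy
  have hsum := congrArg₂ (· + ·) (congrArg₂ (· + ·) hx hy) hzz
  simp only [← Finset.sum_add_distrib] at hsum
  rw [Finset.sum_eq_zero] at hsum
  · norm_num at hsum
  refine fun i _ => Finset.sum_eq_zero fun j _ => Finset.sum_eq_zero fun k _ => ?_
  obtain ⟨l, hl⟩ := hno i j k
  have ht : ∀ a b c a' b' c', a ≤ 1 → b ≤ 1 → c ≤ 1 → a' ≤ 1 → b' ≤ 1 → c' ≤ 1 →
      spernerTetrahedron (L i j k) (L (i + a) (j + b) (k + c)) (L (i + a') (j + b') (k + c'))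
        (L (i + 1) (j + 1) (k + 1)) = 0 := fun a b c a' b' c' ha hb hc ha' hb' hc' => by
    by_contra h
    rcases exists_eq_of_spernerTetrahedron_ne_zero _ _ _ _ h l with h | h | h | h
    · exact hl 0 (by simp) 0 (by simp) 0 (by simp) h
    · exact hl a ha b hb c hc h
    · exact hl a' ha' b' hb' c' hc' h
    · exact hl 1 le_rfl 1 le_rfl 1 le_rfl h
  have e1 := ht 1 0 0 1 1 0 (by simp) (by simp) (by simp) (by simp) (by simp) (by simp)
  have e2 := ht 1 0 0 1 0 1 (by simp) (by simp) (by simp) (by simp) (by simp) (by simp)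
  have e3 := ht 0 1 0 0 1 1 (by simp) (by simp) (by simp) (by simp) (by simp) (by simp)
  have e4 := ht 0 1 0 1 1 0 (by simp) (by simp) (by simp) (by simp) (by simp) (by simp)
  have e5 := ht 0 0 1 1 0 1 (by simp) (by simp) (by simp) (by simp) (by simp) (by simp)
  have e6 := ht 0 0 1 0 1 1 (by simp) (by simp) (by simp) (by simp) (by simp) (by simp)
  simp only [spernerTetrahedron, add_zero] at e1 e2 e3 e4 e5 e6
  linarith

end CubicalSperner

section Lebesgue

variable {X : Type*} [MetricSpace X]

/-- **Lebesgue's covering theorem**: in a space of covering dimension at most two, a continuous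
image of the three-dimensional cube cannot have all three pairs of opposite faces disjoint. -/
theorem CovDimLE.false_of_separated_cube (hdim : CovDimLE X 2) {f : (Fin 3 → ℝ) → X}
    (hf : Continuous f)
    (hsep : ∀ i, ∀ p ∈ Set.Icc (0 : Fin 3 → ℝ) 1, ∀ q ∈ Set.Icc (0 : Fin 3 → ℝ) 1,
      p i = 0 → q i = 1 → f p ≠ f q) : False := by
  classical
  set K := Set.Icc (0 : Fin 3 → ℝ) 1 with hK
  have hKc : IsCompact K := isCompact_Icc
  have hface : ∀ (i : Fin 3) (r : ℝ), IsClosed (f '' (K ∩ {p | p i = r})) := fun i r =>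
    ((hKc.inter_right (isClosed_eq (continuous_apply i) continuous_const)).image hf).isClosed
  set A : Fin 3 → Set X := fun i => f '' (K ∩ {p | p i = 0}) with hA
  set B : Fin 3 → Set X := fun i => f '' (K ∩ {p | p i = 1}) with hB
  obtain ⟨V, hVo, hVc, hVU, hVF⟩ := hdim
    {u | IsOpen u ∧ ∀ i, Disjoint u (A i) ∨ Disjoint u (B i)} (fun u hu => hu.1) (by
      refine Set.eq_univ_of_forall fun x => ?_
      have hC : ∀ i, ∃ C : Set X, IsClosed C ∧ x ∉ C ∧ (C = A i ∨ C = B i) := fun i => by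
        by_cases hx : x ∈ A i
        · refine ⟨B i, hface i 1, ?_, Or.inr rfl⟩
          rintro ⟨q, ⟨hq, hq1⟩, rfl⟩
          obtain ⟨p, ⟨hp, hp0⟩, h⟩ := hx
          exact hsep i p hp q hq hp0 hq1 h
        · exact ⟨A i, hface i 0, hx, Or.inl rfl⟩
      choose C hCc hxC hCAB using hC
      refine ⟨⋂ i, (C i)ᶜ, ⟨isOpen_iInter_of_finite fun i => (hCc i).isOpen_compl, fun i => ?_⟩,
        Set.mem_iInter.2 hxC⟩
      have hd : Disjoint (⋂ i, (C i)ᶜ) (C i) :=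
        Set.disjoint_left.2 fun y hy => Set.mem_iInter.1 hy i
      rcases hCAB i with h | h <;> rw [h] at hd
      exacts [Or.inl hd, Or.inr hd])
  obtain ⟨δ, hδ, hLeb⟩ := lebesgue_number_lemma_of_metric (c := fun v : V => f ⁻¹' v) hKc
    (fun v => (hVo v v.2).preimage hf) (fun p _ => by
      obtain ⟨v, hv, hpv⟩ := Set.mem_sUnion.1 (hVc ▸ Set.mem_univ (f p))
      exact Set.mem_iUnion.2 ⟨⟨v, hv⟩, hpv⟩)
  replace hLeb : ∀ p ∈ K, ∃ v : Set X, v ∈ V ∧ Metric.ball p δ ⊆ f ⁻¹' v := fun p hp =>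
    (hLeb p hp).elim fun v hv => ⟨v, v.2, hv⟩
  choose! v hvV hv using hLeb
  obtain ⟨n, hn⟩ := exists_nat_one_div_lt hδ
  set N := n + 1 with hN
  have hN0 : (0 : ℝ) < N := by positivity
  set r : ℕ → ℝ := fun i => (min i N : ℕ) / N with hr
  have hr0 : r 0 = 0 := by simp [hr]
  have hrN : r N = 1 := by simp [hr, hN0.ne']
  have hr01 : ∀ i, 0 ≤ r i ∧ r i ≤ 1 := fun i => by
    refine ⟨div_nonneg (Nat.cast_nonneg _) hN0.le, div_le_one_of_le₀ ?_ hN0.le⟩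
    exact_mod_cast min_le_right i N
  have hrd : ∀ i, ∀ a ≤ 1, dist (r (i + a)) (r i) < δ := fun i a ha => by
    refine lt_of_le_of_lt ?_ hn
    have h1 : min i N ≤ min (i + a) N := min_le_min_right _ (by omega)
    have h2 : min (i + a) N ≤ min i N + 1 := by omega
    rw [Real.dist_eq, hr, ← sub_div, abs_div, abs_of_pos hN0, ← Nat.cast_succ]
    refine div_le_div_of_nonneg_right ?_ hN0.le
    have h1' : ((min i N : ℕ) : ℝ) ≤ (min (i + a) N : ℕ) := by exact_mod_cast h1
    have h2' : ((min (i + a) N : ℕ) : ℝ) ≤ (min i N : ℕ) + 1 := by exact_mod_cast h2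
    rw [abs_of_nonneg (by linarith)]
    linarith
  set pt : ℕ → ℕ → ℕ → Fin 3 → ℝ := fun i j k => ![r i, r j, r k] with hpt
  have hptK : ∀ i j k, pt i j k ∈ K := fun i j k => by
    refine ⟨fun l => ?_, fun l => ?_⟩ <;> fin_cases l <;> simp [hpt, hr01]
  have hptd : ∀ i j k, ∀ a ≤ 1, ∀ b ≤ 1, ∀ c ≤ 1,
      dist (pt i j k) (pt (i + a) (j + b) (k + c)) < δ := fun i j k a ha b hb c hc => by
    rw [dist_comm, dist_pi_lt_iff hδ]
    intro l
    fin_cases l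
    exacts [hrd i a ha, hrd j b hb, hrd k c hc]
  set color : Set X → Fin 4 := fun w =>
    if (w ∩ A 0).Nonempty then 0 else if (w ∩ A 1).Nonempty then 1
      else if (w ∩ A 2).Nonempty then 2 else 3 with hcolor
  have hmem : ∀ p ∈ K, f p ∈ v p := fun p hp => hv p hp (Metric.mem_ball_self hδ)
  have hmeet : ∀ p ∈ K, ∀ l, p l = 0 → (v p ∩ A l).Nonempty := fun p hp l hl =>
    ⟨f p, hmem p hp, p, ⟨hp, hl⟩, rfl⟩
  have hmiss : ∀ p ∈ K, ∀ l, p l = 1 → ¬ (v p ∩ A l).Nonempty := fun p hp l hl h => by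
    obtain ⟨u, ⟨-, hu⟩, hvu⟩ := hVU _ (hvV p hp)
    rcases hu l with hd | hd
    · exact Set.not_disjoint_iff_nonempty_inter.2 h (hd.mono_left hvu)
    · exact Set.disjoint_left.1 hd (hvu (hmem p hp)) ⟨p, ⟨hp, hl⟩, rfl⟩
  obtain ⟨i, j, k, hcube⟩ := exists_rainbow_cube N (fun i j k => color (v (pt i j k)))
    (fun j k => if_pos (hmeet _ (hptK _ _ _) 0 hr0))
    (fun i k => by
      have := hmeet _ (hptK i 0 k) 1 hr0
      simp only [hcolor, if_pos this]
      split_ifs <;> decide)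
    (fun i j => by
      have := hmeet _ (hptK i j 0) 2 hr0
      simp only [hcolor, if_pos this]
      split_ifs <;> decide)
    (fun j k => by
      have := hmiss _ (hptK N j k) 0 hrN
      simp only [hcolor, if_neg this]
      split_ifs <;> decide)
    (fun i k => by
      have := hmiss _ (hptK i N k) 1 hrN
      simp only [hcolor, if_neg this]
      split_ifs <;> decide)
    (fun i j => by
      have := hmiss _ (hptK i j N) 2 hrN
      simp only [hcolor, if_neg this]
      split_ifs <;> decide)
  choose a ha b hb c hc hl using hcube
  obtain ⟨F, hF, hVF⟩ := hVF (f (pt i j k))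
  set w : Fin 4 → Set X := fun l => v (pt (i + a l) (j + b l) (k + c l)) with hw
  have hwF : ∀ l, w l ∈ F := fun l => by
    refine hVF ⟨hvV _ (hptK _ _ _), hv _ (hptK _ _ _) ?_⟩
    exact hptd i j k _ (ha l) _ (hb l) _ (hc l)
  have hinj : Function.Injective w := fun l l' h => by
    rw [← hl l, ← hl l']
    exact congrArg color h
  have := Finset.card_le_card_of_injOn w (s := Finset.univ) (fun l _ => hwF l) hinj.injOn
  simp at this
  omega

end Lebesgue

section ParallelGrids

variable {X : Type*} [MetricSpace X]

/-- In dimension two there are no two distinct parallel planes. -/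
theorem IsCAT0.false_of_parallel_grids (hX : IsCAT0 X) (hdim : CovDimLE X 2) {h g : X → X}
    {lh lg r δ : ℝ} {P P' : ℝ → ℝ → X} (hr : 0 < r) (hδ : δ ^ 2 < 4)
    (hP : IsGrid h g lh lg P) (hP' : IsGrid h g lh lg P')
    (hd : ∀ u t u' t', dist (P u t) (P' u' t') ^ 2 =
      (u - u') ^ 2 + (t - t') ^ 2 + δ * (u - u') * (t - t') + r ^ 2) : False := by
  choose γ hγ using fun u t => hX.1 (P u t) (P' u t)
  have hdr : ∀ u t, dist (P u t) (P' u t) = r := fun u t => by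
    rw [← abs_of_nonneg (dist_nonneg (x := P u t) (y := P' u t)), ← abs_of_pos hr,
      ← sq_eq_sq_iff_abs_eq_abs, hd]
    ring
  have hdist : ∀ {Q : ℝ → ℝ → X}, IsGrid h g lh lg Q → ∀ u t u' t',
      dist (Q u t) (Q u' t') ≤ |u - u'| + |t - t'| := fun {Q} hQ u t u' t' => by
    rw [← (hQ.fst t).dist_eq, ← (hQ.snd u').dist_eq]
    exact dist_triangle _ _ _
  set σ : ℝ → ℝ := fun s => max 0 (min 1 s) with hσ
  have hσ01 : ∀ s, σ s ∈ Set.Icc (0 : ℝ) 1 := fun s => ⟨le_max_left _ _, by simp [hσ]⟩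
  have hσid : ∀ s ∈ Set.Icc (0 : ℝ) 1, σ s = s := fun s hs => by simp [hσ, hs.1, hs.2]
  have hmem : ∀ s ∈ Set.Icc (0 : ℝ) 1, s * r ∈ Set.Icc 0 r := fun s hs =>
    ⟨mul_nonneg hs.1 hr.le, by nlinarith [hs.2]⟩
  have hs : ∀ u t, ∀ s ∈ Set.Icc (0 : ℝ) 1, ∀ s' ∈ Set.Icc (0 : ℝ) 1,
      dist (γ u t (s * r)) (γ u t (s' * r)) = |s - s'| * r := fun u t s hs s' hs' => by
    have := (hγ u t).2.2 (s * r) (by rw [hdr]; exact hmem s hs) (s' * r)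
      (by rw [hdr]; exact hmem s' hs')
    rw [this, ← sub_mul, abs_mul, abs_of_pos hr]
  have hfst : ∀ u t, ∀ s ∈ Set.Icc (0 : ℝ) 1, dist (P u t) (γ u t (s * r)) = s * r :=
    fun u t s hs' => by
      have := hs u t 0 (by simp) s hs'
      rwa [zero_mul, (hγ u t).1, zero_sub, abs_neg, abs_of_nonneg hs'.1] at this
  have hsnd : ∀ u t, ∀ s ∈ Set.Icc (0 : ℝ) 1, dist (γ u t (s * r)) (P' u t) = (1 - s) * r :=
    fun u t s hs' => by
      have := hs u t s hs' 1 (by simp)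
      have h1 := (hγ u t).2.1
      rw [hdr] at h1
      rwa [one_mul, h1, abs_sub_comm, abs_of_nonneg (by linarith [hs'.2])] at this
  refine hdim.false_of_separated_cube (f := fun p => γ (p 1) (p 2) (σ (p 0) * r)) ?_ ?_
  · have hlip : ∀ p q : Fin 3 → ℝ,
        dist (γ (p 1) (p 2) (σ (p 0) * r)) (γ (q 1) (q 2) (σ (q 0) * r)) ≤
          |σ (p 0) - σ (q 0)| * r + (|p 1 - q 1| + |p 2 - q 2|) := fun p q => by
      have h1 := hs (p 1) (p 2) _ (hσ01 (p 0)) _ (hσ01 (q 0))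
      have h2 := hX.dist_geodesic_le (hγ (p 1) (p 2)) (hγ (q 1) (q 2)) (hσ01 (q 0))
      rw [hdr, hdr] at h2
      have h3 := dist_triangle (γ (p 1) (p 2) (σ (p 0) * r)) (γ (p 1) (p 2) (σ (q 0) * r))
        (γ (q 1) (q 2) (σ (q 0) * r))
      have h4 := mul_le_mul_of_nonneg_left (hdist hP (p 1) (p 2) (q 1) (q 2))
        (sub_nonneg.2 (hσ01 (q 0)).2)
      have h5 := mul_le_mul_of_nonneg_left (hdist hP' (p 1) (p 2) (q 1) (q 2)) (hσ01 (q 0)).1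
      linarith
    refine continuous_iff_continuousAt.2 fun q => tendsto_iff_dist_tendsto_zero.2 ?_
    refine squeeze_zero (fun _ => dist_nonneg) (fun p => hlip p q) ?_
    have : Continuous fun p : Fin 3 → ℝ =>
        |σ (p 0) - σ (q 0)| * r + (|p 1 - q 1| + |p 2 - q 2|) := by
      simp only [hσ]
      fun_prop
    simpa using this.tendsto q
  · intro i p hp q hq hpi hqi heq
    have hp' : ∀ i, p i ∈ Set.Icc (0 : ℝ) 1 := fun i => ⟨hp.1 i, hp.2 i⟩
    have hq' : ∀ i, q i ∈ Set.Icc (0 : ℝ) 1 := fun i => ⟨hq.1 i, hq.2 i⟩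
    simp only [hσid _ (hp' 0), hσid _ (hq' 0)] at heq
    have h1 := dist_triangle (P (p 1) (p 2)) (γ (p 1) (p 2) (p 0 * r)) (P' (q 1) (q 2))
    rw [hfst _ _ _ (hp' 0), heq, hsnd _ _ _ (hq' 0)] at h1
    have h2 := dist_triangle (P (q 1) (q 2)) (γ (q 1) (q 2) (q 0 * r)) (P' (p 1) (p 2))
    rw [hfst _ _ _ (hq' 0), ← heq, hsnd _ _ _ (hp' 0)] at h2
    have e1 := hd (p 1) (p 2) (q 1) (q 2)
    have e2 := hd (q 1) (q 2) (p 1) (p 2)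
    have n1 := dist_nonneg (x := P (p 1) (p 2)) (y := P' (q 1) (q 2))
    have n2 := dist_nonneg (x := P (q 1) (q 2)) (y := P' (p 1) (p 2))
    have e : dist (P (p 1) (p 2)) (P' (q 1) (q 2)) = dist (P (q 1) (q 2)) (P' (p 1) (p 2)) := by
      rw [← abs_of_nonneg n1, ← abs_of_nonneg n2, ← sq_eq_sq_iff_abs_eq_abs, e1, e2]
      ring
    rw [← e] at h2
    set D := dist (P (p 1) (p 2)) (P' (q 1) (q 2))
    have hD : D ^ 2 ≤ r ^ 2 := by
      have : D ≤ r := by nlinarith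
      exact pow_le_pow_left₀ n1 this 2
    have hq0 : (p 1 - q 1) ^ 2 + (p 2 - q 2) ^ 2 + δ * (p 1 - q 1) * (p 2 - q 2) =
        (p 1 - q 1 + δ / 2 * (p 2 - q 2)) ^ 2 + (1 - δ ^ 2 / 4) * (p 2 - q 2) ^ 2 := by ring
    have hpos : 0 < 1 - δ ^ 2 / 4 := by linarith
    have hsq2 : (p 2 - q 2) ^ 2 = 0 := by
      have := mul_nonneg hpos.le (sq_nonneg (p 2 - q 2))
      have h0 : (1 - δ ^ 2 / 4) * (p 2 - q 2) ^ 2 = 0 := by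
        nlinarith [sq_nonneg (p 1 - q 1 + δ / 2 * (p 2 - q 2))]
      exact (mul_eq_zero.1 h0).resolve_left hpos.ne'
    have h20 := pow_eq_zero_iff two_ne_zero |>.1 hsq2
    rw [h20] at e1
    have h10 : p 1 - q 1 = 0 := by nlinarith [sq_nonneg (p 1 - q 1)]
    fin_cases i
    · simp only [Fin.zero_eta, Fin.isValue] at hpi hqi
      rw [hpi, hqi] at h1
      have hD0 : D = 0 := by linarith
      rw [hD0, h10] at e1
      nlinarith
    · simp only [Fin.mk_one, Fin.isValue] at hpi hqi
      linarith
    · simp only [Fin.reduceFinMk, Fin.isValue] at hpi hqi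
      linarith

theorem nonpos_of_forall_mul_sq_le {e b c : ℝ} (h : ∀ n : ℝ, e * n ^ 2 ≤ b * n + c) : e ≤ 0 := by
  by_contra! he
  have h1 := h ((|b| + |c|) / e + 1)
  set n := (|b| + |c|) / e + 1 with hn
  have hn1 : 1 ≤ n := by
    have : 0 ≤ (|b| + |c|) / e := by positivity
    linarith
  have hen : e * n = |b| + |c| + e := by rw [hn]; field_simp
  have h2 : e * n ^ 2 = (|b| + |c| + e) * n := by rw [← hen]; ring
  nlinarith [le_abs_self b, le_abs_self c, abs_nonneg c,
    mul_le_mul_of_nonneg_right (le_abs_self b) (by linarith : (0 : ℝ) ≤ n)]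

/-- In dimension two, every grid meets a given non-degenerate grid of the same isometries. -/
theorem IsCAT0.exists_eq_of_grids (hX : IsCAT0 X) (hdim : CovDimLE X 2) {h g : X ≃ᵢ X}
    {lh lg δ : ℝ} {P P' : ℝ → ℝ → X} (hlh : 0 < lh) (hlg : 0 < lg)
    (hP : IsGrid h g lh lg P) (hP' : IsGrid h g lh lg P') (hδ : δ ^ 2 < 4)
    (hself : ∀ u t u' t', dist (P u t) (P u' t') ^ 2 =
      (u - u') ^ 2 + (t - t') ^ 2 + δ * (u - u') * (t - t')) : ∃ u t, P u t = P' 0 0 := by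
  obtain ⟨α, β, γ, η, H⟩ := hX.exists_dist_sq_grid hlh hlg hP hP'
  have hcmp : ∀ u t : ℝ, u ^ 2 + t ^ 2 + δ * u * t ≤ 2 * (u ^ 2 + t ^ 2 + η * u * t) := by
    intro u t
    rw [← sub_nonpos]
    refine nonpos_of_forall_mul_sq_le (b := 2 * (β * u + γ * t))
      (c := 2 * α + 2 * dist (P' 0 0) (P 0 0) ^ 2) fun n => ?_
    have h1 := dist_triangle (P (n * u) (n * t)) (P' 0 0) (P 0 0)
    have h2 := H (n * u) (n * t) 0 0
    have h3 := hself (n * u) (n * t) 0 0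
    simp only [sub_zero] at h2 h3
    have h4 := pow_le_pow_left₀ dist_nonneg h1 2
    have h5 := add_sq_le (a := dist (P (n * u) (n * t)) (P' 0 0)) (b := dist (P' 0 0) (P 0 0))
    nlinarith
  have hη : η ^ 2 < 4 := by
    have h1 := hcmp 1 1
    have h2 := hcmp 1 (-1)
    have h3 := abs_lt_of_sq_lt_sq (show δ ^ 2 < 2 ^ 2 by linarith) (by norm_num)
    rw [abs_lt] at h3
    nlinarith
  have hη' : 4 - η ^ 2 ≠ 0 := by linarith
  set u₀ := (η * γ - 2 * β) / (4 - η ^ 2) with hu₀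
  set t₀ := (η * β - 2 * γ) / (4 - η ^ 2) with ht₀
  have hβ : 2 * u₀ + η * t₀ = -β := by rw [hu₀, ht₀]; field_simp; ring
  have hγ : 2 * t₀ + η * u₀ = -γ := by rw [hu₀, ht₀]; field_simp; ring
  have H' : ∀ u t u' t', dist (P u t) (P' (u' + -u₀) (t' + -t₀)) ^ 2 =
      (u - u') ^ 2 + (t - t') ^ 2 + η * (u - u') * (t - t') +
        (α + β * u₀ / 2 + γ * t₀ / 2) := fun u t u' t' => by
    rw [H]
    linear_combination (u - u' + u₀ / 2) * hβ + (t - t' + t₀ / 2) * hγ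
  have hm0 : 0 ≤ α + β * u₀ / 2 + γ * t₀ / 2 := by
    have := H' 0 0 0 0
    simp only [sub_self] at this
    nlinarith [sq_nonneg (dist (P 0 0) (P' (0 + -u₀) (0 + -t₀)))]
  rcases hm0.eq_or_lt with hm | hm
  · refine ⟨u₀, t₀, ?_⟩
    have := H' u₀ t₀ u₀ t₀
    rw [← hm] at this
    simpa using this
  · refine (hX.false_of_parallel_grids hdim (Real.sqrt_pos.2 hm) hη hP (hP'.shift (-u₀) (-t₀))
      fun u t u' t' => ?_).elim
    rw [Real.sq_sqrt hm0]
    exact H' u t u' t'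

end ParallelGrids

section Flats

variable {G X : Type*} [Group G] [MetricSpace X]

/-- `Q` is an isometrically embedded Euclidean plane on which `g` translates by `l` in the second
direction and `h` translates by `(a, τ)`, in a transverse direction. -/
structure IsFlat (h g : X → X) (l a τ : ℝ) (Q : ℝ → ℝ → X) : Prop where
  ne : a ≠ 0
  dist_sq : ∀ p t p' t', dist (Q p t) (Q p' t') ^ 2 = (p - p') ^ 2 + (t - t') ^ 2
  map_snd : ∀ p t, g (Q p t) = Q p (t + l)
  map_fst : ∀ p t, h (Q p t) = Q (p + a) (t + τ)

theorem IsFlat.dist_fst {h g : X → X} {l a τ : ℝ} {Q : ℝ → ℝ → X} (hQ : IsFlat h g l a τ Q)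
    (p p' t : ℝ) : dist (Q p t) (Q p' t) = |p - p'| := by
  rw [← abs_of_nonneg (dist_nonneg (x := Q p t)), ← sq_eq_sq_iff_abs_eq_abs, hQ.dist_sq]
  ring

theorem IsFlat.isTransLine {h g : X → X} {l a τ : ℝ} {Q : ℝ → ℝ → X} (hQ : IsFlat h g l a τ Q)
    (p : ℝ) : IsTransLine g l (Q p) :=
  ⟨fun s t => by
    rw [← abs_of_nonneg (dist_nonneg (x := Q p s)), ← sq_eq_sq_iff_abs_eq_abs, hQ.dist_sq]
    ring, hQ.map_snd p⟩

theorem IsFlat.continuous {h g : X → X} {l a τ : ℝ} {Q : ℝ → ℝ → X} (hQ : IsFlat h g l a τ Q) :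
    Continuous fun v : ℝ × ℝ => Q v.1 v.2 := by
  refine continuous_iff_continuousAt.2 fun v => tendsto_iff_dist_tendsto_zero.2 ?_
  refine squeeze_zero (g := fun w : ℝ × ℝ => |w.1 - v.1| + |w.2 - v.2|) (fun _ => dist_nonneg)
    (fun w => ?_) ?_
  · rw [← hQ.dist_fst w.1 v.1 w.2, ← (hQ.isTransLine v.1).dist_eq]
    exact dist_triangle _ _ _
  · have : Continuous fun w : ℝ × ℝ => |w.1 - v.1| + |w.2 - v.2| := by fun_prop
    simpa using this.tendsto v

theorem IsFlat.reflect {h g : X → X} {l a τ : ℝ} {Q : ℝ → ℝ → X} (hQ : IsFlat h g l a τ Q)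
    {ε : ℝ} (hε : ε ^ 2 = 1) : IsFlat h g l (ε * a) τ fun p => Q (ε * p) where
  ne := mul_ne_zero (fun h0 => by simp [h0] at hε) hQ.ne
  dist_sq p t p' t' := by
    rw [hQ.dist_sq]
    linear_combination (p - p') ^ 2 * hε
  map_snd p t := hQ.map_snd _ t
  map_fst p t := by
    rw [hQ.map_fst]
    congr 1
    linear_combination -a * hε

theorem map_zpow_apply_of_plane_translation {φ : G →* (X ≃ᵢ X)} {h : G} {Q : ℝ → ℝ → X} {a τ : ℝ}
    (hQ : ∀ p t, φ h (Q p t) = Q (p + a) (t + τ)) (n : ℤ) (p t : ℝ) :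
    φ (h ^ n) (Q p t) = Q (p + n * a) (t + n * τ) := by
  have := map_zpow_apply_of_translation (φ := φ) (g := h) (V := ℝ × ℝ)
    (Q := fun v => Q v.1 v.2) (v := (a, τ)) (fun v => hQ v.1 v.2) n (p, t)
  simpa using this

variable {φ : G →* (X ≃ᵢ X)} {g h h₁ h₂ : G} {l a a₁ a₂ τ τ₁ τ₂ : ℝ} {Q Q₁ Q₂ : ℝ → ℝ → X}

theorem IsFlat.inv (hQ : IsFlat (φ h) (φ g) l a τ Q) : IsFlat (φ h⁻¹) (φ g) l (-a) (-τ) Q where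
  ne := neg_ne_zero.2 hQ.ne
  dist_sq := hQ.dist_sq
  map_snd := hQ.map_snd
  map_fst p t := by
    have := map_zpow_apply_of_plane_translation hQ.map_fst (-1) p t
    simpa using this

theorem IsFlat.exists_pos (hQ : IsFlat (φ h) (φ g) l a τ Q) :
    ∃ h' a' τ', 0 < a' ∧ IsFlat (φ h') (φ g) l a' τ' Q := by
  rcases hQ.ne.lt_or_gt with ha | ha
  · exact ⟨_, _, _, neg_pos.2 ha, hQ.inv⟩
  · exact ⟨_, _, _, ha, hQ⟩

/-- The common points of the minsets of two isometries generating a free abelian group of rank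
two form a periodic flat. -/
theorem ProperlyDisc.exists_flat (hpd : ProperlyDisc φ) (hX : IsCAT0 X) (hdim : CovDimLE X 2)
    (hcomm : Commute h g) (hfree : ∀ i j : ℤ, h ^ i * g ^ j = 1 → i = 0 ∧ j = 0)
    (hlh : 0 < transLen (φ h)) (hlg : 0 < transLen (φ g)) {x : X}
    (hx : x ∈ MinSet (φ h) ∩ MinSet (φ g)) :
    ∃ Q a τ, Q 0 0 = x ∧ IsFlat (φ h) (φ g) (transLen (φ g)) a τ Q ∧
      ∀ y, y ∈ MinSet (φ h) ∩ MinSet (φ g) ↔ ∃ p t, Q p t = y := by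
  have hc : ∀ x, φ g (φ h x) = φ h (φ g x) := fun x => by
    rw [← IsometryEquiv.mul_apply, ← IsometryEquiv.mul_apply, ← map_mul, ← map_mul, hcomm.eq]
  obtain ⟨P, hP0, hP⟩ := hX.exists_grid hc hlh hlg hx.1 hx.2
  obtain ⟨δ, hself⟩ := hX.exists_dist_sq_self_grid hlh hlg hP
  have hδ := hpd.grid_nondegenerate hfree hlg hP hself
  have hν0 : 0 < 1 - δ ^ 2 / 4 := by linarith
  set ν := Real.sqrt (1 - δ ^ 2 / 4) with hν
  have hνpos : 0 < ν := Real.sqrt_pos.2 hν0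
  have hνsq : ν ^ 2 = 1 - δ ^ 2 / 4 := Real.sq_sqrt hν0.le
  have hmemP : ∀ u t, P u t ∈ MinSet (φ h) ∩ MinSet (φ g) := fun u t => by
    constructor
    · change dist (P u t) (φ h (P u t)) = _
      rw [(hP.fst t).map_eq u, (hP.fst t).dist_eq]
      simp [abs_of_pos hlh]
    · change dist (P u t) (φ g (P u t)) = _
      rw [(hP.snd u).map_eq t, (hP.snd u).dist_eq]
      simp [abs_of_pos hlg]
  refine ⟨fun p t => P (p / ν) (t - δ / 2 * (p / ν)), ν * transLen (φ h), δ / 2 * transLen (φ h),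
    by simp [hP0], ⟨by positivity, fun p t p' t' => ?_, fun p t => ?_, fun p t => ?_⟩,
    fun y => ⟨fun hy => ?_, ?_⟩⟩
  · rw [hself]
    have h1 : p - p' = ν * (p / ν - p' / ν) := by field_simp
    rw [h1, mul_pow, hνsq]
    ring
  · rw [(hP.snd _).map_eq]
    congr 1
    ring
  · rw [(hP.fst _).map_eq]
    have h1 : (p + ν * transLen (φ h)) / ν = p / ν + transLen (φ h) := by field_simp
    rw [h1]
    congr 1
    ring
  · obtain ⟨P', hP'0, hP'⟩ := hX.exists_grid hc hlh hlg hy.1 hy.2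
    obtain ⟨u, t, hut⟩ := hX.exists_eq_of_grids hdim hlh hlg hP hP' hδ hself
    refine ⟨ν * u, t + δ / 2 * u, ?_⟩
    dsimp only
    rw [mul_div_cancel_left₀ _ hνpos.ne', add_sub_cancel_right, hut, hP'0]
  · rintro ⟨p, t, rfl⟩
    exact hmemP _ _

/-- A periodic flat is contained in every periodic flat with which it shares a half-plane. -/
theorem ProperlyDisc.exists_eq_of_common_halfPlane (hpd : ProperlyDisc φ) (hl : 0 < l)
    (hQ₁ : IsFlat (φ h₁) (φ g) l a₁ τ₁ Q₁) (hQ₂ : IsFlat (φ h₂) (φ g) l a₂ τ₂ Q₂)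
    (heq : ∀ p, 0 ≤ p → ∀ t, Q₁ p t = Q₂ p t) (p t : ℝ) : ∃ p' t', Q₂ p' t' = Q₁ p t := by
  obtain ⟨h₁, a₁, τ₁, ha₁, hQ₁⟩ := hQ₁.exists_pos
  obtain ⟨h₂, a₂, τ₂, ha₂, hQ₂⟩ := hQ₂.exists_pos
  have hz₁ : ∀ (n : ℕ) p t, φ (h₁ ^ n) (Q₁ p t) = Q₁ (p + n * a₁) (t + n * τ₁) := fun n p t => by
    have := map_zpow_apply_of_plane_translation hQ₁.map_fst n p t
    rwa [zpow_natCast] at this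
  have hz₂ := map_zpow_apply_of_plane_translation hQ₂.map_fst
  have hzg : ∀ (n : ℤ) p t, φ (g ^ n) (Q₂ p t) = Q₂ p (t + n * l) := fun n p t => by
    have := map_zpow_apply_of_plane_translation (Q := Q₂) (a := 0) (τ := l)
      (fun p t => by rw [add_zero]; exact hQ₂.map_snd p t) n p t
    rwa [mul_zero, add_zero] at this
  set M : ℕ → ℤ := fun n => ⌊n * a₁ / a₂⌋ with hM
  set K : ℕ → ℤ := fun n => ⌊(n * τ₁ - M n * τ₂) / l⌋ with hK
  obtain ⟨m, n, hmn, hF⟩ := hpd.exists_ne_eq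
    (K := (fun v : ℝ × ℝ => Q₂ v.1 v.2) '' (Set.Icc 0 a₂ ×ˢ Set.Icc 0 l)) (x := Q₂ 0 0)
    ((isCompact_Icc.prod isCompact_Icc).image hQ₂.continuous)
    ⟨(0, 0), ⟨⟨le_rfl, ha₂.le⟩, le_rfl, hl.le⟩, rfl⟩
    (F := fun n : ℕ => g ^ (-K n) * (h₂ ^ (-M n) * h₁ ^ n)) fun n => by
      rw [map_mul, map_mul, IsometryEquiv.mul_apply, IsometryEquiv.mul_apply, ← heq 0 le_rfl, hz₁,
        heq _ (by positivity), hz₂, hzg]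
      refine ⟨(_, _), ⟨⟨?_, ?_⟩, ?_, ?_⟩, rfl⟩
      · have := Int.floor_le (n * a₁ / a₂)
        rw [le_div_iff₀ ha₂] at this
        simp only [hM]; push_cast; linarith
      · have := (Int.lt_floor_add_one (n * a₁ / a₂)).le
        rw [div_le_iff₀ ha₂] at this
        simp only [hM]; push_cast; linarith
      · have := Int.floor_le ((n * τ₁ - M n * τ₂) / l)
        rw [le_div_iff₀ hl] at this
        simp only [hK]; push_cast; linarith
      · have := (Int.lt_floor_add_one ((n * τ₁ - M n * τ₂) / l)).le
        rw [div_le_iff₀ hl] at this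
        simp only [hK]; push_cast; linarith
  obtain ⟨b, hb, rfl⟩ : ∃ b, 0 < b ∧ n = b + m := ⟨n - m, by omega, by omega⟩
  obtain ⟨A, T, hAT⟩ : ∃ A T, ∀ p t, φ (h₁ ^ b) (Q₂ p t) = Q₂ (p + A) (t + T) := by
    have hw : h₁ ^ b = h₂ ^ M (b + m) * (g ^ (K (b + m) - K m) * h₂ ^ (-M m)) := by
      rw [pow_add] at hF
      refine mul_right_cancel (b := h₁ ^ m) ?_
      have := congrArg (fun z => h₂ ^ M (b + m) * (g ^ K (b + m) * z)) hF
      simp only [zpow_neg, mul_inv_cancel_left] at this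
      rw [← this, zpow_sub, zpow_neg]
      simp only [mul_assoc]
    refine ⟨(-M m : ℤ) * a₂ + M (b + m) * a₂,
      (-M m : ℤ) * τ₂ + (K (b + m) - K m : ℤ) * l + M (b + m) * τ₂, fun p t => ?_⟩
    rw [hw, map_mul, map_mul, IsometryEquiv.mul_apply, IsometryEquiv.mul_apply, hz₂, hzg, hz₂]
    congr 1 <;> ring
  obtain ⟨j, hj⟩ := exists_nat_ge (-p / (b * a₁))
  have hba : 0 < b * a₁ := by positivity
  rw [div_le_iff₀ hba] at hj
  have hj₂ := map_zpow_apply_of_plane_translation hAT j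
  refine ⟨p + (b * j : ℕ) * a₁ - j * A, t + (b * j : ℕ) * τ₁ - j * T, ?_⟩
  refine (φ ((h₁ ^ b) ^ (j : ℤ))).injective ?_
  rw [hj₂, zpow_natCast, ← pow_mul, hz₁, heq]
  · push_cast
    congr 1 <;> ring
  · push_cast
    linarith

/-- Two periodic flats through a common point agree if the second one contains a ray of the
first which is perpendicular to the common axis. -/
theorem ProperlyDisc.exists_eq_iff_of_ray (hpd : ProperlyDisc φ) (hX : IsCAT0 X) (hl : 0 < l)
    (hQ₁ : IsFlat (φ h₁) (φ g) l a₁ τ₁ Q₁) (hQ₂ : IsFlat (φ h₂) (φ g) l a₂ τ₂ Q₂)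
    (h0 : Q₁ 0 0 = Q₂ 0 0) (hray : ∀ p, 0 ≤ p → ∃ p' t', Q₂ p' t' = Q₁ p 0) (y : X) :
    (∃ p t, Q₁ p t = y) ↔ ∃ p t, Q₂ p t = y := by
  have haxis : ∀ {p p' : ℝ}, Q₁ p 0 = Q₂ p' 0 → ∀ t, Q₁ p t = Q₂ p' t := fun h t =>
    hX.transLine_unique (φ g).isometry hl (hQ₁.isTransLine _) (hQ₂.isTransLine _) h t
  have hray' : ∀ p, 0 ≤ p → ∃ p', p' ^ 2 = p ^ 2 ∧ Q₁ p 0 = Q₂ p' 0 := fun p hp => by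
    obtain ⟨p', t', h⟩ := hray p hp
    have hd : ∀ s, p ^ 2 + s ^ 2 = p' ^ 2 + (t' - s) ^ 2 := fun s => by
      have e1 := hQ₁.dist_sq p 0 0 s
      have e2 := hQ₂.dist_sq p' t' 0 s
      rw [← h, haxis h0, e2] at e1
      linarith
    have h1 := hd 0
    have h2 := hd 1
    obtain rfl : t' = 0 := by linarith
    exact ⟨p', by linarith, h.symm⟩
  obtain ⟨ε, hε, h1⟩ := hray' 1 zero_le_one
  rw [one_pow] at hε
  have hhalf : ∀ p, 0 ≤ p → ∀ t, Q₁ p t = Q₂ (ε * p) t := fun p hp => by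
    obtain ⟨p', hp', h⟩ := hray' p hp
    have e1 := hQ₁.dist_sq p 0 1 0
    have e2 := hQ₂.dist_sq p' 0 ε 0
    rw [h, h1, e2] at e1
    have e3 : p' = ε * p := by
      have : p' * ε = p := by nlinarith
      rw [← this]
      linear_combination -p' * hε
    exact haxis (e3 ▸ h)
  have hQ₂' := hQ₂.reflect hε
  constructor
  · rintro ⟨p, t, rfl⟩
    obtain ⟨p', t', h⟩ := hpd.exists_eq_of_common_halfPlane hl hQ₁ hQ₂' hhalf p t
    exact ⟨_, _, h⟩
  · rintro ⟨p, t, rfl⟩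
    obtain ⟨p', t', h⟩ := hpd.exists_eq_of_common_halfPlane hl hQ₂' hQ₁
      (fun p hp t => (hhalf p hp t).symm) (ε * p) t
    refine ⟨p', t', h.trans ?_⟩
    rw [← mul_assoc, ← pow_two, hε, one_mul]

end Flats

theorem StripWithAxes.not_isAxisOf {X : Type*} [MetricSpace X] {f : X → X} {S : Set X}
    (hS : StripWithAxes f S) : ¬ IsAxisOf f S := by
  rintro ⟨c, hc, rfl, -⟩
  obtain ⟨w, hw, j, hj, hrange, -⟩ := hS
  have hmem : ∀ p, ∃ r, c r = j p := fun p => hrange.subset (Set.mem_range_self p)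
  choose r hr using hmem
  have hd : ∀ p q, (r p - r q) ^ 2 = ((p.1 : ℝ) - q.1) ^ 2 + (p.2 - q.2) ^ 2 := fun p q => by
    rw [← sq_abs, ← hc, hr, hr, hj, Real.sq_sqrt (by positivity)]
  have d₁ := hd (⟨w, hw.le, le_rfl⟩, 0) (⟨0, le_rfl, hw.le⟩, 0)
  have d₂ := hd (⟨0, le_rfl, hw.le⟩, 1) (⟨0, le_rfl, hw.le⟩, 0)
  have d₃ := hd (⟨w, hw.le, le_rfl⟩, 0) (⟨0, le_rfl, hw.le⟩, 1)
  simp only [sub_self, sub_zero] at d₁ d₂ d₃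
  set A := r (⟨w, hw.le, le_rfl⟩, 0) - r (⟨0, le_rfl, hw.le⟩, 0)
  set B := r (⟨0, le_rfl, hw.le⟩, 1) - r (⟨0, le_rfl, hw.le⟩, 0)
  have hAB : A * B = 0 := by nlinarith
  have : w ^ 2 = 0 := by
    have := congrArg (· ^ 2) hAB
    simp only [mul_pow, d₁, d₂] at this
    linarith
  exact hw.ne' (pow_eq_zero_iff two_ne_zero |>.1 this)

theorem isAxisOf_or_stripWithAxes_of_ordConnected {X : Type*} [MetricSpace X] {h g : X → X}
    {a τ : ℝ} {Q : ℝ → ℝ → X} (hQ : IsFlat h g (transLen g) a τ Q) {S : Set ℝ} {M : Set X}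
    (hne : S.Nonempty) (hconn : S.OrdConnected) (hcl : IsClosed S) (hbb : BddBelow S)
    (hba : BddAbove S) (hM : ∀ y, y ∈ M ↔ ∃ p ∈ S, ∃ t, Q p t = y) :
    IsAxisOf g M ∨ StripWithAxes g M := by
  obtain ⟨b, c, rfl⟩ : ∃ b c, S = Set.Icc b c :=
    ⟨_, _, eq_Icc_csInf_csSup_of_connected_bdd_closed
      ⟨hne, hconn.isPreconnected⟩ hbb hba hcl⟩
  have haxis : ∀ p, IsAxisOf g (Set.range (Q p)) := fun p =>
    ⟨Q p, (hQ.isTransLine p).dist_eq, rfl, hQ.map_snd p⟩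
  rcases (Set.nonempty_Icc.1 hne).eq_or_lt with rfl | hbc
  · left
    convert haxis b
    ext y
    simp [hM]
  · refine Or.inr ⟨c - b, sub_pos.2 hbc, fun v => Q (b + v.1) v.2, fun v v' => ?_, ?_,
      fun s => haxis (b + s)⟩
    · rw [← Real.sqrt_sq (dist_nonneg (x := Q _ _)), hQ.dist_sq, add_sub_add_left_eq_sub]
    · ext y
      rw [hM]
      constructor
      · rintro ⟨⟨⟨s, hs⟩, t⟩, rfl⟩
        exact ⟨b + s, ⟨by linarith [hs.1], by linarith [hs.2]⟩, t, rfl⟩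
      · rintro ⟨p, hp, t, rfl⟩
        exact ⟨(⟨p - b, by linarith [hp.1], by linarith [hp.2]⟩, t), by simp⟩

/-- Configurations of two distinct periodic flats in the minset of an
infinite-order element: exactly one of (1) disjoint, (2) intersection a single axis of `g`,
(3) intersection a flat strip of positive width foliated by axes of `g`. -/
theorem periodic_flats_in_minset_trichotomy
    (G : Type*) [Group G] (X : Type*) [MetricSpace X]
    (hX : IsCAT0 X) (hdim : CovDimLE X 2)
    (φ : G →* (X ≃ᵢ X)) (hpd : ProperlyDisc φ) (hss : ∀ h : G, SemiSimple ⇑(φ h))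
    (g h₁ h₂ : G)
    (hg : ∀ k : ℤ, k ≠ 0 → g ^ k ≠ 1)
    (hc1 : Commute h₁ g) (hc2 : Commute h₂ g)
    (hfree1 : ∀ i j : ℤ, h₁ ^ i * g ^ j = 1 → i = 0 ∧ j = 0)
    (hfree2 : ∀ i j : ℤ, h₂ ^ i * g ^ j = 1 → i = 0 ∧ j = 0)
    (hne : MinSet ⇑(φ h₁) ∩ MinSet ⇑(φ g) ≠ MinSet ⇑(φ h₂) ∩ MinSet ⇑(φ g)) :
    let M := (MinSet ⇑(φ h₁) ∩ MinSet ⇑(φ g)) ∩ (MinSet ⇑(φ h₂) ∩ MinSet ⇑(φ g))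
    (M = ∅ ∧ ¬ IsAxisOf ⇑(φ g) M ∧ ¬ StripWithAxes ⇑(φ g) M) ∨
    (M ≠ ∅ ∧ IsAxisOf ⇑(φ g) M ∧ ¬ StripWithAxes ⇑(φ g) M) ∨
    (M ≠ ∅ ∧ ¬ IsAxisOf ⇑(φ g) M ∧ StripWithAxes ⇑(φ g) M) := by
  intro M
  rcases M.eq_empty_or_nonempty with hM | ⟨x, hx₁, hx₂⟩
  · refine Or.inl ⟨hM, ?_, ?_⟩ <;> rw [hM]
    · rintro ⟨c, -, hc, -⟩
      exact (Set.range_nonempty c).ne_empty hc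
    · rintro ⟨w, hw, j, -, hj, -⟩
      exact Set.notMem_empty _ (hj.subset ⟨(⟨0, le_rfl, hw.le⟩, 0), rfl⟩)
  have hl := hpd.transLen_pos hg hx₁.2
  have hinf : ∀ {h : G}, (∀ i j : ℤ, h ^ i * g ^ j = 1 → i = 0 ∧ j = 0) →
      ∀ k : ℤ, k ≠ 0 → h ^ k ≠ 1 := fun hfree k hk hk1 => hk (hfree k 0 (by simp [hk1])).1
  have hl₁ := hpd.transLen_pos (hinf hfree1) hx₁.1
  have hl₂ := hpd.transLen_pos (hinf hfree2) hx₂.1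
  obtain ⟨Q₁, a₁, τ₁, h0₁, hQ₁, hmem₁⟩ := hpd.exists_flat hX hdim hc1 hfree1 hl₁ hl hx₁
  obtain ⟨Q₂, a₂, τ₂, h0₂, hQ₂, hmem₂⟩ := hpd.exists_flat hX hdim hc2 hfree2 hl₂ hl hx₂
  have hline : ∀ p s t, Q₁ p s ∈ MinSet (φ h₂) ∩ MinSet (φ g) →
      Q₁ p t ∈ MinSet (φ h₂) ∩ MinSet (φ g) := fun p s t h => by
    obtain ⟨p', t', h'⟩ := (hmem₂ _).1 h
    refine (hmem₂ _).2 ⟨p', t + (t' - s), ?_⟩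
    refine hX.transLine_unique (φ g).isometry hl ((hQ₂.isTransLine p').shift (t' - s))
      (hQ₁.isTransLine p) (a := s) ?_ t
    simpa using h'
  set S : Set ℝ := {p | dist (Q₁ p 0) (φ h₂ (Q₁ p 0)) ≤ transLen (φ h₂)} with hS
  have hSmem : ∀ p, p ∈ S ↔ Q₁ p 0 ∈ MinSet (φ h₂) ∩ MinSet (φ g) := fun p =>
    ⟨fun hp => ⟨le_antisymm hp (transLen_le _ _), ((hmem₁ _).2 ⟨p, 0, rfl⟩).2⟩, fun hp => hp.1.le⟩
  have h0S : (0 : ℝ) ∈ S := (hSmem 0).2 (h0₁ ▸ hx₂)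
  have hfst : ∀ s t, dist (Q₁ s 0) (Q₁ t 0) = |s - t| := fun s t => hQ₁.dist_fst s t 0
  have hcont : Continuous fun p => Q₁ p 0 :=
    (Isometry.of_dist_eq fun s t => by rw [hfst, Real.dist_eq]).continuous
  have hcl : IsClosed S :=
    isClosed_le (hcont.dist ((φ h₂).continuous.comp hcont)) continuous_const
  have hconn : S.OrdConnected := by
    have := (hX.convexOn_dist hfst fun s t => ((φ h₂).isometry.dist_eq _ _).trans
      (hfst s t)).convex_le (transLen (φ h₂))
    simpa [hS] using this.ordConnected
  have hbdd : ∀ {a τ : ℝ} {Q : ℝ → ℝ → X}, IsFlat (φ h₁) (φ g) (transLen (φ g)) a τ Q →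
      Q 0 0 = x → (∀ y, (∃ p t, Q p t = y) ↔ ∃ p t, Q₁ p t = y) →
      ¬ ∀ p, 0 ≤ p → Q p 0 ∈ MinSet (φ h₂) ∩ MinSet (φ g) := fun hQ h0 hiff hray => by
    refine hne (Set.ext fun y => ?_)
    rw [hmem₁, hmem₂, ← hiff]
    exact hpd.exists_eq_iff_of_ray hX hl hQ hQ₂ (h0.trans h0₂.symm)
      (fun p hp => (hmem₂ _).1 (hray p hp)) y
  have hba : BddAbove S := by
    by_contra hba
    refine hbdd hQ₁ h0₁ (fun y => Iff.rfl) fun p hp => (hSmem p).1 ?_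
    obtain ⟨q, hq, hpq⟩ := not_bddAbove_iff.1 hba p
    exact hconn.out h0S hq ⟨hp, hpq.le⟩
  have hbb : BddBelow S := by
    by_contra hbb
    refine hbdd (hQ₁.reflect (ε := -1) (by norm_num)) (by simpa using h0₁) (fun y => ?_)
      fun p hp => (hSmem _).1 ?_
    · constructor
      · rintro ⟨p, t, h⟩
        exact ⟨_, _, h⟩
      · rintro ⟨p, t, h⟩
        exact ⟨-p, t, by simpa using h⟩
    · obtain ⟨q, hq, hpq⟩ := not_bddBelow_iff.1 hbb (-1 * p)
      exact hconn.out hq h0S ⟨hpq.le, by linarith⟩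
  have hM : ∀ y, y ∈ M ↔ ∃ p ∈ S, ∃ t, Q₁ p t = y := fun y => by
    constructor
    · rintro ⟨hy₁, hy₂⟩
      obtain ⟨p, t, rfl⟩ := (hmem₁ y).1 hy₁
      exact ⟨p, (hSmem p).2 (hline p t 0 hy₂), t, rfl⟩
    · rintro ⟨p, hp, t, rfl⟩
      exact ⟨(hmem₁ _).2 ⟨p, t, rfl⟩, hline p 0 t ((hSmem p).1 hp)⟩
  have hMne : M ≠ ∅ := Set.Nonempty.ne_empty ⟨x, hx₁, hx₂⟩
  rcases isAxisOf_or_stripWithAxes_of_ordConnected hQ₁ ⟨0, h0S⟩ hconn hcl hbb hba hM with h | h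
  · exact Or.inr (Or.inl ⟨hMne, h, fun hs => hs.not_isAxisOf h⟩)
  · exact Or.inr (Or.inr ⟨hMne, h.not_isAxisOf, h⟩)
end

section
/- Let T be a complete ℝ-tree and let a and b be hyperbolic isometries of T such that the composite isometry a ∘ b has a fixed point. Then there exist points p, q ∈ Min(a) ∩ Min(b) with dist(p,q) = min(ℓ(a), ℓ(b)) such that the geodesic segment [p,q] is contained in Min(a) ∩ Min(b), and such that for every point x on [p,q] one has dist(a x, b x) = ℓ(a) + ℓ(b) (expressing that a and b translate in opposite directions along the common segment [p,q] of their axes). -/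
theorem IsGeodesic.symm {X : Type*} [MetricSpace X] {x y : X} {γ : ℝ → X}
    (h : IsGeodesic x y γ) : IsGeodesic y x (fun t => γ (dist x y - t)) := by
  obtain ⟨h0, h1, h2⟩ := h
  refine ⟨by simpa using h1, by simpa [dist_comm y x] using h0, fun s hs t ht => ?_⟩
  rw [dist_comm y x] at hs ht
  rw [h2 _ ⟨by linarith [hs.2], by linarith [hs.1]⟩ _ ⟨by linarith [ht.2], by linarith [ht.1]⟩,
    abs_sub_comm]
  congr 1
  ring

theorem IsGeodesic.dist_left {X : Type*} [MetricSpace X] {x y : X} {γ : ℝ → X}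
    (h : IsGeodesic x y γ) {s : ℝ} (hs : s ∈ Set.Icc (0 : ℝ) (dist x y)) :
    dist x (γ s) = s := by
  have := h.2.2 0 ⟨le_rfl, dist_nonneg⟩ s hs
  rwa [h.1, zero_sub, abs_neg, abs_of_nonneg hs.1] at this

theorem IsGeodesic.dist_right {X : Type*} [MetricSpace X] {x y : X} {γ : ℝ → X}
    (h : IsGeodesic x y γ) {s : ℝ} (hs : s ∈ Set.Icc (0 : ℝ) (dist x y)) :
    dist (γ s) y = dist x y - s := by
  have := h.2.2 s hs (dist x y) ⟨dist_nonneg, le_rfl⟩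
  rwa [h.2.1, abs_sub_comm, abs_of_nonneg (by linarith [hs.2])] at this

theorem IsGeodesic.restrict {X : Type*} [MetricSpace X] {x y : X} {γ : ℝ → X}
    (h : IsGeodesic x y γ) {u v : ℝ} (hu : 0 ≤ u) (huv : u ≤ v) (hv : v ≤ dist x y) :
    dist (γ u) (γ v) = v - u ∧ IsGeodesic (γ u) (γ v) (fun t => γ (u + t)) := by
  have hd : dist (γ u) (γ v) = v - u := by
    rw [h.2.2 u ⟨hu, huv.trans hv⟩ v ⟨hu.trans huv, hv⟩, abs_sub_comm,
      abs_of_nonneg (by linarith)]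
  refine ⟨hd, by simp, by simp [hd], fun s hs t ht => ?_⟩
  rw [hd] at hs ht
  rw [h.2.2 _ ⟨by linarith [hs.1], by linarith [hs.2]⟩ _ ⟨by linarith [ht.1], by linarith [ht.2]⟩]
  congr 1
  ring

theorem transLen_le_dist {X : Type*} [MetricSpace X] (f : X → X) (x : X) :
    transLen f ≤ dist x (f x) :=
  csInf_le ⟨0, by rintro _ ⟨y, rfl⟩; exact dist_nonneg⟩ ⟨x, rfl⟩

theorem IsRTree.dist_apply_apply_le {T : Type*} [MetricSpace T] (hT : IsRTree T)
    (g : T ≃ᵢ T) (x w : T) : dist x (g (g x)) ≤ dist x (g x) + dist w (g w) := by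
  have h := hT.2 x (g (g x)) (g x) (g w)
  simp only [g.dist_eq] at h
  have h1 := dist_triangle x w (g w)
  have h2 := dist_triangle (g x) (g w) w
  rw [g.dist_eq, dist_comm (g w) w] at h2
  rcases le_max_iff.1 h with h | h <;> linarith [dist_comm (g x) x]

/-- The part of length `transLen g` in the middle of a geodesic from `x` to `g x` is
contained in the minset of `g`. -/
theorem IsRTree.mem_minSet {T : Type*} [MetricSpace T] (hT : IsRTree T) (g : T ≃ᵢ T)
    (hg : SemiSimple ⇑g) {x : T} {γ : ℝ → T} (hγ : IsGeodesic x (g x) γ) {s : ℝ}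
    (hs : |2 * s - dist x (g x)| ≤ transLen ⇑g) : γ s ∈ MinSet ⇑g := by
  obtain ⟨w, hw⟩ := hg
  have hE := hT.dist_apply_apply_le g x w
  rw [hw] at hE
  have hD := transLen_le_dist g x
  obtain ⟨hs1, hs2⟩ := abs_le.1 hs
  have hl : 0 ≤ transLen ⇑g := hw ▸ dist_nonneg
  refine le_antisymm ?_ (transLen_le_dist g _)
  set D := dist x (g x)
  set l := transLen ⇑g
  have hu : (D + l) / 2 ∈ Set.Icc (0 : ℝ) D := ⟨by linarith, by linarith⟩
  have hv : (D - l) / 2 ∈ Set.Icc (0 : ℝ) D := ⟨by linarith, by linarith⟩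
  have hsI : s ∈ Set.Icc (0 : ℝ) D := ⟨by linarith, by linarith⟩
  have u1 := hγ.dist_left hu
  have u2 := hγ.dist_right hu
  have v1 := hγ.dist_left hv
  have v2 := hγ.dist_right hv
  have key : dist (γ ((D + l) / 2)) (g (γ ((D - l) / 2))) ≤ 0 := by
    have h1 := hT.2 (γ ((D + l) / 2)) (g (g x)) x (g x)
    have h2 := hT.2 (γ ((D + l) / 2)) (g (γ ((D - l) / 2))) (g (g x)) (g x)
    simp only [g.dist_eq] at h1 h2
    rw [dist_comm (g x) x, dist_comm (g (g x)) x, dist_comm _ x] at h1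
    have h3 : dist (γ ((D + l) / 2)) (g (g x)) ≤ (D + l) / 2 := by
      rcases le_max_iff.1 h1 with h | h <;> linarith
    rcases le_max_iff.1 h2 with h | h <;>
      linarith [dist_comm x (γ ((D - l) / 2)), dist_comm (g x) x]
  have heq := dist_le_zero.1 key
  have t := dist_triangle (γ s) (γ ((D + l) / 2)) (g (γ s))
  rw [heq, g.dist_eq, ← heq, hγ.2.2 _ hsI _ hu, hγ.2.2 _ hv _ hsI,
    abs_of_nonpos (by linarith), abs_of_nonpos (by linarith)] at t
  linarith

/-- If `a` maps `y` to `x` and `b` maps `x` to `y`, then `a` and `b` translate in opposite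
directions along the middle of the geodesic from `x` to `y`. -/
theorem IsRTree.add_transLen_le_dist {T : Type*} [MetricSpace T] (hT : IsRTree T)
    (a b : T ≃ᵢ T) {x y : T} (hay : a y = x) (hbx : b x = y) {γ : ℝ → T}
    (hγ : IsGeodesic x y γ) {s : ℝ} (hs : s ∈ Set.Icc (0 : ℝ) (dist x y))
    (hsa : dist x y - 2 * s < transLen ⇑a) (hsb : 2 * s - dist x y < transLen ⇑b) :
    transLen ⇑a + transLen ⇑b ≤ dist (a (γ s)) (b (γ s)) := by
  have z1 := hγ.dist_left hs
  have z2 := hγ.dist_right hs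
  have la := transLen_le_dist a (γ s)
  have lb := transLen_le_dist b (γ s)
  have xa : dist x (a (γ s)) = dist x y - s := by rw [← hay, a.dist_eq, hay, dist_comm, z2]
  have yb : dist y (b (γ s)) = s := by rw [← hbx, b.dist_eq, z1]
  have h1 := hT.2 y x (γ s) (a (γ s))
  have h2 := hT.2 y (a (γ s)) (b (γ s)) (γ s)
  rw [dist_comm y x, dist_comm y (γ s)] at h1
  rw [dist_comm y (γ s), dist_comm (a (γ s)) (γ s), dist_comm (b (γ s)) (γ s)] at h2
  rcases le_max_iff.1 h1 with h | h <;> rcases le_max_iff.1 h2 with h' | h' <;> linarith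

/-- If `a`, `b` are hyperbolic isometries of a complete ℝ-tree such that
`a ∘ b` has a fixed point, then their axes share a segment of length `min (ℓ(a), ℓ(b))`
along which they translate in opposite directions. -/
theorem rtree_hyperbolic_axes_overlap
    (T : Type*) [MetricSpace T] [CompleteSpace T] (hT : IsRTree T)
    (a b : T ≃ᵢ T)
    (ha : SemiSimple ⇑a) (hla : 0 < transLen ⇑a)
    (hb : SemiSimple ⇑b) (hlb : 0 < transLen ⇑b)
    (hfix : ∃ x : T, a (b x) = x) :
    ∃ p q : T, p ∈ MinSet ⇑a ∩ MinSet ⇑b ∧ q ∈ MinSet ⇑a ∩ MinSet ⇑b ∧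
      dist p q = min (transLen ⇑a) (transLen ⇑b) ∧
      ∃ γ : ℝ → T, IsGeodesic p q γ ∧
        ∀ t ∈ Set.Icc (0:ℝ) (dist p q),
          γ t ∈ MinSet ⇑a ∩ MinSet ⇑b ∧
          dist (a (γ t)) (b (γ t)) = transLen ⇑a + transLen ⇑b := by
  obtain ⟨x, hx⟩ := hfix
  obtain ⟨γ, hγ⟩ := hT.1 x (b x)
  set y := b x with hy
  set D := dist x y with hD
  set M := min (transLen ⇑a) (transLen ⇑b)
  have hM0 : 0 < M := lt_min hla hlb
  have hMa : M ≤ transLen ⇑a := min_le_left _ _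
  have hMb : M ≤ transLen ⇑b := min_le_right _ _
  have hDb : transLen ⇑b ≤ D := transLen_le_dist b x
  have hmem : ∀ s, |2 * s - D| ≤ M → γ s ∈ MinSet ⇑a ∩ MinSet ⇑b := by
    intro s hs
    refine ⟨?_, hT.mem_minSet b hb hγ (hs.trans hMb)⟩
    have hγ' := hγ.symm
    rw [← hx] at hγ'
    have := hT.mem_minSet a ha (x := y) (s := D - s) hγ' (by
      rw [hx, dist_comm y x, ← hD, show 2 * (D - s) - D = -(2 * s - D) by ring, abs_neg]
      exact hs.trans hMa)
    simpa [hx, hD] using this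
  have hle : ∀ s, |2 * s - D| ≤ M →
      transLen ⇑a + transLen ⇑b ≤ dist (a (γ s)) (b (γ s)) := by
    intro s hs
    obtain ⟨hs1, hs2⟩ := abs_le.1 hs
    refine le_of_forall_pos_le_add fun ε hε => ?_
    obtain ⟨r, hr1, hr2, hrs⟩ : ∃ r, -M < 2 * r - D ∧ 2 * r - D < M ∧ |r - s| ≤ ε / 2 := by
      have hc := lt_min (half_pos hε) (by positivity : 0 < M / 4)
      have hc1 := min_le_left (ε / 2) (M / 4)
      have hc2 := min_le_right (ε / 2) (M / 4)
      rcases le_total (2 * s - D) 0 with h | h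
      · exact ⟨s + min (ε / 2) (M / 4), by linarith, by linarith, by
          rw [abs_le]; constructor <;> linarith⟩
      · exact ⟨s - min (ε / 2) (M / 4), by linarith, by linarith, by
          rw [abs_le]; constructor <;> linarith⟩
    have hrI : r ∈ Set.Icc (0 : ℝ) D := ⟨by linarith, by linarith⟩
    have hsI : s ∈ Set.Icc (0 : ℝ) D := ⟨by linarith, by linarith⟩
    have h := hT.add_transLen_le_dist a b hx hy.symm hγ hrI (by linarith) (by linarith)
    have t := dist_triangle4 (a (γ r)) (a (γ s)) (b (γ s)) (b (γ r))
    rw [a.dist_eq, b.dist_eq, dist_comm (γ s) (γ r), hγ.2.2 r hrI s hsI] at t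
    linarith
  obtain ⟨hpq, hgeo⟩ := hγ.restrict (u := (D - M) / 2) (v := (D + M) / 2)
    (by linarith) (by linarith) (by linarith)
  replace hpq : dist (γ ((D - M) / 2)) (γ ((D + M) / 2)) = M := by rw [hpq]; ring
  refine ⟨γ ((D - M) / 2), γ ((D + M) / 2), hmem _ ?_, hmem _ ?_, hpq, _, hgeo, ?_⟩
  · rw [abs_le]; constructor <;> linarith
  · rw [abs_le]; constructor <;> linarith
  · intro t ht
    rw [hpq] at ht
    have hs : |2 * ((D - M) / 2 + t) - D| ≤ M := by
      rw [abs_le]; constructor <;> linarith [ht.1, ht.2]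
    have hm := hmem _ hs
    refine ⟨hm, le_antisymm ?_ (hle _ hs)⟩
    have h1 : dist _ _ = _ := hm.1
    have h2 : dist _ _ = _ := hm.2
    have h3 := dist_triangle_left (a (γ ((D - M) / 2 + t))) (b (γ ((D - M) / 2 + t)))
      (γ ((D - M) / 2 + t))
    linarith
end
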